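/- arXiv:math/0507172 — 3 statements merged into one kernel-verified Lean document; each statement's English description precedes it below -/
import Mathlib

section
/- For z ∈ ℂ+ one has Im Υ(z) ≥ 0 and Im(zΥ(z)) ≥ 0 (as Hermitian matrices). Moreover there exist a positive N×N matrix-valued measure μ and a positive n×n matrix-valued measure μ̃ such that μ(ℝ+) = I_N, μ̃(ℝ+) = I_n, and Υ(z) = ∫_{[0,∞)} (λ − z)⁻¹ μ(dλ) and Υ̃(z) = ∫_{[0,∞)} (λ − z)⁻¹ μ̃(dλ) for all z ∈ ℂ ∖ ℝ+. In particular, (1/N)Tr Υ(z) and (1/n)Tr Υ̃(z) belong to S(ℝ+). -/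
open MeasureTheory Matrix Complex Filter
open scoped Topology ComplexOrder

noncomputable section

/-- The set `ℂ ∖ ℝ₊`. -/
def offRplus : Set ℂ := {z : ℂ | ¬ (z.im = 0 ∧ 0 ≤ z.re)}

/-- `f` is the Stieltjes transform of a probability measure carried by `ℝ₊`. -/
def IsStieltjesPM (f : ℂ → ℂ) : Prop :=
  ∃ μ : Measure ℝ, IsProbabilityMeasure μ ∧ μ (Set.Iio 0) = 0 ∧
    ∀ z ∈ offRplus, f z = ∫ t, ((t : ℂ) - z)⁻¹ ∂μ
def Tmat {N n : ℕ} (A : Matrix (Fin N) (Fin n) ℝ)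
    (ψ : Fin N → ℂ → ℂ) (ψt : Fin n → ℂ → ℂ) (z : ℂ) : Matrix (Fin N) (Fin N) ℂ :=
  ((Matrix.diagonal fun i => ψ i z)⁻¹
    - z • (A.map Complex.ofReal * Matrix.diagonal (fun j => ψt j z) * (A.map Complex.ofReal)ᵀ))⁻¹

def Ttmat {N n : ℕ} (A : Matrix (Fin N) (Fin n) ℝ)
    (ψ : Fin N → ℂ → ℂ) (ψt : Fin n → ℂ → ℂ) (z : ℂ) : Matrix (Fin n) (Fin n) ℂ :=
  ((Matrix.diagonal fun j => ψt j z)⁻¹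
    - z • ((A.map Complex.ofReal)ᵀ * Matrix.diagonal (fun i => ψ i z) * A.map Complex.ofReal))⁻¹

def SolvesSystem {N n : ℕ} (σ : Fin N → Fin n → ℝ) (A : Matrix (Fin N) (Fin n) ℝ)
    (ψ : Fin N → ℂ → ℂ) (ψt : Fin n → ℂ → ℂ) : Prop :=
  (∀ i, IsStieltjesPM (ψ i)) ∧ (∀ j, IsStieltjesPM (ψt j)) ∧
  ∀ z ∈ offRplus,
    (∀ i, ψ i z
      = -(z * (1 + (n : ℂ)⁻¹
          * ((Matrix.diagonal fun j => ((σ i j : ℂ))^2) * Ttmat A ψ ψt z).trace))⁻¹) ∧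
    (∀ j, ψt j z
      = -(z * (1 + (n : ℂ)⁻¹
          * ((Matrix.diagonal fun i => ((σ i j : ℂ))^2) * Tmat A ψ ψt z).trace))⁻¹)

def HasUnitMatrixMeasureRep (d : ℕ) (F : ℂ → Matrix (Fin d) (Fin d) ℂ) : Prop :=
  ∃ (τ : Measure ℝ) (ρ : ℝ → Matrix (Fin d) (Fin d) ℂ),
    τ (Set.Iio 0) = 0 ∧
    (∀ i j, Measurable fun t : ℝ => ρ t i j) ∧
    (∀ᵐ t ∂τ, (ρ t).PosSemidef) ∧
    (∀ i j, Integrable (fun t : ℝ => ρ t i j) τ) ∧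
    (Matrix.of fun i j => ∫ t, ρ t i j ∂τ) = (1 : Matrix (Fin d) (Fin d) ℂ) ∧
    ∀ z ∈ offRplus,
      (∀ i j, Integrable (fun t : ℝ => ((t : ℂ) - z)⁻¹ * ρ t i j) τ) ∧
      F z = Matrix.of fun i j => ∫ t, ((t : ℂ) - z)⁻¹ * ρ t i j ∂τ

/-- The "imaginary part" `(M - M*) / (2i)` of a square complex matrix. -/
def matIm {d : ℕ} (M : Matrix (Fin d) (Fin d) ℂ) : Matrix (Fin d) (Fin d) ℂ :=
  (2 * Complex.I)⁻¹ • (M - Mᴴ)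


lemma aux_ne {z : ℂ} (hz : z ∈ offRplus) {t : ℝ} (ht : 0 ≤ t) : (t : ℂ) - z ≠ 0 := by
  intro h
  apply hz
  have : z = (t : ℂ) := (sub_eq_zero.mp h).symm
  subst this
  simpa using ht

lemma aux_finite_level {N n : ℕ} {ι κ : Type} [Fintype ι] [DecidableEq ι] [Fintype κ]
    [DecidableEq κ] (C : Matrix (Fin N) (Fin n) ℂ) (x : ι → ℝ) (hx : ∀ a, 0 ≤ x a)
    (y : κ → ℝ) (hy : ∀ a, 0 ≤ y a) (E : Matrix ι (Fin N) ℂ) (hE : Eᴴ * E = 1)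
    (G : Matrix κ (Fin n) ℂ) (hG : Gᴴ * G = 1) :
    ∃ (lam : ι ⊕ κ → ℝ) (V : Matrix (Fin N) (ι ⊕ κ) ℂ), (∀ a, 0 ≤ lam a) ∧ V * Vᴴ = 1 ∧
      ∀ z ∈ offRplus, ∀ (U Γ : Matrix (Fin N) (Fin N) ℂ) (Γt : Matrix (Fin n) (Fin n) ℂ),
        U = V * Matrix.diagonal (fun a => ((lam a : ℂ) - z)⁻¹) * Vᴴ →
        Γ = Eᴴ * Matrix.diagonal (fun a => ((x a : ℂ) - z)⁻¹) * E →
        Γt = Gᴴ * Matrix.diagonal (fun a => ((y a : ℂ) - z)⁻¹) * G →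
        U = Γ + z • (Γ * C * Γt * Cᴴ * U) := by
  classical
  set Y : Matrix ι ι ℂ := Matrix.diagonal (fun a => ((Real.sqrt (x a) : ℝ) : ℂ)) with hY
  set Yt : Matrix κ κ ℂ := Matrix.diagonal (fun a => ((Real.sqrt (y a) : ℝ) : ℂ)) with hYt
  set Z : Matrix (ι ⊕ κ) (ι ⊕ κ) ℂ := Matrix.fromBlocks Y (-(E * C * Gᴴ)) 0 Yt with hZ
  set P := Z * Zᴴ with hPdef
  have hP : P.PosSemidef := Matrix.posSemidef_self_mul_conjTranspose Z
  set W : Matrix (ι ⊕ κ) (ι ⊕ κ) ℂ := (hP.1.eigenvectorUnitary : Matrix (ι ⊕ κ) (ι ⊕ κ) ℂ) with hW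
  have hWW : W * Wᴴ = 1 := by
    have := Unitary.mul_star_self_of_mem hP.1.eigenvectorUnitary.2
    simpa [Matrix.star_eq_conjTranspose] using this
  have hWW' : Wᴴ * W = 1 := by
    have := Unitary.star_mul_self_of_mem hP.1.eigenvectorUnitary.2
    simpa [Matrix.star_eq_conjTranspose] using this
  set lam := hP.1.eigenvalues with hlam
  have hspec : P = W * Matrix.diagonal (fun a => (lam a : ℂ)) * Wᴴ := by
    have := hP.1.spectral_theorem
    rw [Unitary.conjStarAlgAut_apply] at this
    exact this
  set F : Matrix (ι ⊕ κ) (Fin N) ℂ := Matrix.fromRows E 0 with hF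
  have hFF : Fᴴ * F = 1 := by
    rw [hF, Matrix.conjTranspose_fromRows_eq_fromCols_conjTranspose, Matrix.fromCols_mul_fromRows]
    simp [hE]
  refine ⟨lam, Fᴴ * W, fun a => hP.eigenvalues_nonneg a, ?_, ?_⟩
  · rw [Matrix.conjTranspose_mul, Matrix.conjTranspose_conjTranspose, Matrix.mul_assoc,
      ← Matrix.mul_assoc W, hWW, Matrix.one_mul, hFF]
  intro z hz U Γ Γt hU hΓ hΓt
  set Dl : Matrix (ι ⊕ κ) (ι ⊕ κ) ℂ := Matrix.diagonal (fun a => ((lam a : ℂ) - z)⁻¹) with hDl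
  set Q := W * Dl * Wᴴ with hQ
  have hPz : P - z • (1 : Matrix (ι ⊕ κ) (ι ⊕ κ) ℂ)
      = W * Matrix.diagonal (fun a => (lam a : ℂ) - z) * Wᴴ := by
    have h2 : Matrix.diagonal (fun a => (lam a : ℂ) - z)
      = Matrix.diagonal (fun a => (lam a : ℂ)) - z • (1 : Matrix (ι ⊕ κ) (ι ⊕ κ) ℂ) := by
      rw [← Matrix.diagonal_one, ← Matrix.diagonal_smul, Matrix.diagonal_sub]
      simp
    rw [h2, Matrix.mul_sub, Matrix.sub_mul, ← hspec]
    simp [hWW]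
  have hdd : Matrix.diagonal (fun a => (lam a : ℂ) - z) * Dl = 1 := by
    rw [hDl, Matrix.diagonal_mul_diagonal, ← Matrix.diagonal_one]
    congr 1
    funext a
    exact mul_inv_cancel₀ (aux_ne hz (hP.eigenvalues_nonneg a))
  have hPQ : (P - z • (1 : Matrix (ι ⊕ κ) (ι ⊕ κ) ℂ)) * Q = 1 := by
    rw [hPz, hQ]
    calc _ = W * Matrix.diagonal (fun a => (lam a : ℂ) - z) * (Wᴴ * W) * Dl * Wᴴ := by
            simp only [Matrix.mul_assoc]
      _ = W * (Matrix.diagonal (fun a => (lam a : ℂ) - z) * Dl) * Wᴴ := by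
            rw [hWW']; simp only [Matrix.mul_assoc, Matrix.one_mul]
      _ = 1 := by rw [hdd, Matrix.mul_one, hWW]
  set R1 := (Q * F).toRows₁ with hR1
  set R2 := (Q * F).toRows₂ with hR2
  have hR : Q * F = Matrix.fromRows R1 R2 := (Matrix.fromRows_toRows _).symm
  have hUR : U = Eᴴ * R1 := by
    rw [hU, Matrix.conjTranspose_mul, Matrix.conjTranspose_conjTranspose]
    have : Fᴴ * W * Dl * (Wᴴ * F) = Fᴴ * (Q * F) := by
      rw [hQ]; simp only [Matrix.mul_assoc]
    rw [this, hR, hF, Matrix.conjTranspose_fromRows_eq_fromCols_conjTranspose,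
      Matrix.fromCols_mul_fromRows]
    simp
  have hYY : Yᴴ = Y := by
    rw [hY, Matrix.diagonal_conjTranspose]; congr 1; funext a; simp
  have hYYt : Ytᴴ = Yt := by
    rw [hYt, Matrix.diagonal_conjTranspose]; congr 1; funext a; simp
  set X : Matrix ι ι ℂ := Matrix.diagonal (fun a => (x a : ℂ)) with hX
  set Xt : Matrix κ κ ℂ := Matrix.diagonal (fun a => (y a : ℂ)) with hXt
  have hYX : Y * Y = X := by
    rw [hY, hX, Matrix.diagonal_mul_diagonal]; congr 1; funext a
    rw [← Complex.ofReal_mul, Real.mul_self_sqrt (hx a)]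
  have hYXt : Yt * Yt = Xt := by
    rw [hYt, hXt, Matrix.diagonal_mul_diagonal]; congr 1; funext a
    rw [← Complex.ofReal_mul, Real.mul_self_sqrt (hy a)]
  have hmain : (P - z • (1 : Matrix (ι ⊕ κ) (ι ⊕ κ) ℂ)) * (Q * F) = F := by
    rw [← Matrix.mul_assoc, hPQ, Matrix.one_mul]
  have hPblk : P = Matrix.fromBlocks (X + E * C * Cᴴ * Eᴴ) (-(E * C * Gᴴ * Yt))
      (-(Yt * G * Cᴴ * Eᴴ)) Xt := by
    rw [hPdef, hZ, Matrix.fromBlocks_conjTranspose, Matrix.fromBlocks_multiply]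
    simp only [hYY, hYYt, hYX, hYXt, Matrix.conjTranspose_zero, Matrix.mul_zero, Matrix.zero_mul,
      zero_add, Matrix.neg_mul, Matrix.conjTranspose_neg, Matrix.mul_neg, neg_neg,
      Matrix.conjTranspose_mul, Matrix.conjTranspose_conjTranspose]
    congr 2
    · calc E * C * Gᴴ * (G * (Cᴴ * Eᴴ)) = E * C * (Gᴴ * G) * Cᴴ * Eᴴ := by
            simp only [Matrix.mul_assoc]
        _ = _ := by rw [hG]; simp only [Matrix.mul_assoc, Matrix.one_mul]
    · simp only [Matrix.mul_assoc]
  rw [Matrix.sub_mul, hPblk, hR, Matrix.fromBlocks_mul_fromRows, Matrix.smul_mul, Matrix.one_mul,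
    hF] at hmain
  have e1 : (X + E * C * Cᴴ * Eᴴ) * R1 + -(E * C * Gᴴ * Yt) * R2 - z • R1 = E := by
    ext i j
    have := congrFun (congrFun hmain (Sum.inl i)) j
    simpa using this
  have e2 : -(Yt * G * Cᴴ * Eᴴ) * R1 + Xt * R2 - z • R2 = 0 := by
    ext i j
    have := congrFun (congrFun hmain (Sum.inr i)) j
    simpa using this
  set S : Matrix ι ι ℂ := Matrix.diagonal (fun a => ((x a : ℂ) - z)⁻¹) with hS
  set St : Matrix κ κ ℂ := Matrix.diagonal (fun a => ((y a : ℂ) - z)⁻¹) with hSt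
  have hSX : S * (X - z • 1) = 1 := by
    rw [← Matrix.diagonal_one, ← Matrix.diagonal_smul, hX, Matrix.diagonal_sub, hS,
      Matrix.diagonal_mul_diagonal]
    congr 1; funext a
    simpa using inv_mul_cancel₀ (aux_ne hz (hx a))
  have hStX : St * (Xt - z • 1) = 1 := by
    rw [← Matrix.diagonal_one, ← Matrix.diagonal_smul, hXt, Matrix.diagonal_sub, hSt,
      Matrix.diagonal_mul_diagonal]
    congr 1; funext a
    simpa using inv_mul_cancel₀ (aux_ne hz (hy a))
  have hYSY : Yt * St * Yt = 1 + z • St := by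
    rw [← Matrix.diagonal_one, ← Matrix.diagonal_smul, hSt, hYt, Matrix.diagonal_add,
      Matrix.diagonal_mul_diagonal, Matrix.diagonal_mul_diagonal]
    congr 1; funext a
    have h1 : ((Real.sqrt (y a) : ℝ) : ℂ) * ((Real.sqrt (y a) : ℝ) : ℂ) = y a := by
      rw [← Complex.ofReal_mul, Real.mul_self_sqrt (hy a)]
    have h2 := aux_ne hz (hy a)
    simp only [Pi.smul_apply, smul_eq_mul]
    rw [mul_right_comm, h1]
    field_simp
    ring
  have r2 : R2 = St * (Yt * (G * (Cᴴ * U))) := by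
    have : (Xt - z • 1) * R2 = Yt * (G * (Cᴴ * U)) := by
      rw [Matrix.sub_mul, Matrix.smul_mul, Matrix.one_mul, hUR]
      have : Xt * R2 - z • R2 = (Yt * G * Cᴴ * Eᴴ) * R1 := by
        rw [Matrix.neg_mul] at e2
        rw [← sub_eq_zero, ← e2]; abel
      rw [this]; simp only [Matrix.mul_assoc]
    rw [← this, ← Matrix.mul_assoc, hStX, Matrix.one_mul]
  have r3 : Gᴴ * (Yt * R2) = Cᴴ * U + z • (Γt * (Cᴴ * U)) := by
    calc Gᴴ * (Yt * R2) = Gᴴ * (Yt * St * Yt) * G * (Cᴴ * U) := by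
          rw [r2]; simp only [Matrix.mul_assoc]
      _ = (Gᴴ * G) * (Cᴴ * U) + z • ((Gᴴ * St * G) * (Cᴴ * U)) := by
          rw [hYSY]
          simp only [Matrix.mul_add, Matrix.add_mul, Matrix.mul_one, Matrix.mul_smul,
            Matrix.smul_mul]
      _ = _ := by rw [hG, ← hΓt, Matrix.one_mul]
  have r1 : (X - z • 1) * R1 = E + z • (E * (C * (Γt * (Cᴴ * U)))) := by
    have h1 : (X - z • 1) * R1 = E + E * C * (Gᴴ * (Yt * R2)) - E * C * (Cᴴ * U) := by
      rw [hUR, Matrix.sub_mul, Matrix.smul_mul, Matrix.one_mul]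
      rw [Matrix.neg_mul, Matrix.add_mul] at e1
      simp only [Matrix.mul_assoc] at e1 ⊢
      calc X * R1 - z • R1 = (X * R1 + E * (C * (Cᴴ * (Eᴴ * R1))) +
            -(E * (C * (Gᴴ * (Yt * R2)))) - z • R1) + E * (C * (Gᴴ * (Yt * R2)))
            - E * (C * (Cᴴ * (Eᴴ * R1))) := by abel
        _ = _ := by rw [e1]
    rw [h1, r3]
    simp only [Matrix.mul_add, Matrix.mul_smul, Matrix.mul_assoc]
    abel
  have r0 : R1 = S * (E + z • (E * (C * (Γt * (Cᴴ * U))))) := by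
    rw [← r1, ← Matrix.mul_assoc, hSX, Matrix.one_mul]
  nth_rewrite 1 [hUR]
  rw [r0, hΓ]
  simp only [Matrix.mul_add, Matrix.mul_smul, Matrix.mul_assoc]

/-- vectors with coordinates in the closed unit disc -/
abbrev VecD (N : ℕ) : Type := Fin N → ↥(Metric.closedBall (0 : ℂ) 1)

abbrev KSp (N : ℕ) : Type := ↥(Set.Icc (0 : ℝ) 1) × VecD N


/-- the inverse coordinate -/
def uOf (t : ℝ) (ht : 0 ≤ t) : ↥(Set.Icc (0 : ℝ) 1) :=
  ⟨(1 + t)⁻¹, by positivity, inv_le_one_of_one_le₀ (by linarith)⟩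

lemma aux_measure_of_finite {N : ℕ} (hN : 0 < N) {ω : Type} [Fintype ω]
    (lam : ω → ℝ) (hlam : ∀ a, 0 ≤ lam a) (V : Matrix (Fin N) ω ℂ) (hV : V * Vᴴ = 1) :
    ∃ σ : ProbabilityMeasure (KSp N), ∀ (f : ↥(Set.Icc (0 : ℝ) 1) → ℂ) (i j : Fin N),
      ∫ p, f p.1 * ((p.2 i : ℂ) * star (p.2 j : ℂ)) ∂(σ : Measure (KSp N))
        = (N : ℂ)⁻¹ * ∑ a, f (uOf (lam a) (hlam a)) * (V i a * star (V j a)) := by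
  classical
  have hN0 : (N : ℝ) ≠ 0 := by positivity
  set c : ω → ℝ := fun a => ∑ i, ‖V i a‖ ^ 2 with hc
  have hc0 : ∀ a, 0 ≤ c a := fun a => Finset.sum_nonneg fun i _ => by positivity
  have hle : ∀ a i, ‖V i a‖ ≤ Real.sqrt (c a) := fun a i => by
    apply Real.le_sqrt_of_sq_le
    exact Finset.single_le_sum (f := fun i => ‖V i a‖ ^ 2) (fun i _ => by positivity)
      (Finset.mem_univ i)
  let v : ω → VecD N := fun a i => ⟨V i a / (Real.sqrt (c a) : ℂ), by
    rw [mem_closedBall_zero_iff, norm_div, Complex.norm_real, Real.norm_of_nonneg (Real.sqrt_nonneg _)]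
    exact div_le_one_of_le₀ (hle a i) (Real.sqrt_nonneg _)⟩
  have hvv : ∀ a i j, (c a : ℂ) * ((v a i : ℂ) * star (v a j : ℂ)) = V i a * star (V j a) := by
    intro a i j
    by_cases h : c a = 0
    · have h1 : ∀ i, V i a = 0 := fun i => by
        have := hle a i
        rw [h, Real.sqrt_zero] at this
        exact norm_le_zero_iff.mp this
      simp [h, h1]
    · have h1 : ((Real.sqrt (c a) : ℝ) : ℂ) * ((Real.sqrt (c a) : ℝ) : ℂ) = c a := by
        rw [← Complex.ofReal_mul, Real.mul_self_sqrt (hc0 a)]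
      have h2 : ((Real.sqrt (c a) : ℝ) : ℂ) ≠ 0 := by
        intro h3; rw [h3, mul_zero] at h1; exact h (by exact_mod_cast h1.symm)
      simp only [v, star_div₀]
      have h4 : star ((Real.sqrt (c a) : ℝ) : ℂ) = ((Real.sqrt (c a) : ℝ) : ℂ) := Complex.conj_ofReal _
      rw [h4, ← h1]
      field_simp
  have hsum : ∑ a, c a = N := by
    have h1 := congrArg Matrix.trace hV
    have h2 : ((∑ a, c a : ℝ) : ℂ) = (N : ℂ) := by
      rw [Matrix.trace_one, Fintype.card_fin] at h1
      rw [← h1, Matrix.trace]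
      simp only [hc, Matrix.diag_apply, Matrix.mul_apply, Matrix.conjTranspose_apply]
      rw [Finset.sum_comm]
      push_cast
      refine Finset.sum_congr rfl fun a _ => Finset.sum_congr rfl fun i _ => ?_
      rw [← Complex.mul_conj']; rfl
    exact_mod_cast h2
  let m : Measure (KSp N) :=
    ∑ a, ENNReal.ofReal (c a / N) • Measure.dirac (uOf (lam a) (hlam a), v a)
  have hm : IsProbabilityMeasure m := by
    constructor
    simp only [m, Measure.coe_finsetSum, Finset.sum_apply, Measure.smul_apply, measure_univ,
      smul_eq_mul, mul_one]
    rw [← ENNReal.ofReal_sum_of_nonneg (fun a _ => by have := hc0 a; positivity), ← Finset.sum_div,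
      hsum, div_self hN0, ENNReal.ofReal_one]
  refine ⟨⟨m, hm⟩, fun f i j => ?_⟩
  simp only [ProbabilityMeasure.coe_mk, m]
  rw [integral_finsetSum_measure]
  · rw [Finset.mul_sum]
    refine Finset.sum_congr rfl fun a _ => ?_
    rw [integral_smul_measure, integral_dirac, ENNReal.toReal_ofReal (by have := hc0 a; positivity),
      ← hvv, Complex.real_smul]
    push_cast
    ring
  · intro a _
    refine Integrable.smul_measure ?_ ENNReal.ofReal_ne_top
    exact integrable_dirac enorm_lt_top

/-- `1/(t-z)` in the coordinate `u = 1/(1+t)`. -/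
def cK (z : ℂ) (u : ↥(Set.Icc (0 : ℝ) 1)) : ℂ := (u : ℝ) * (1 - (1 + z) * (u : ℝ))⁻¹

lemma cK_den {z : ℂ} (hz : z ∈ offRplus) (u : ↥(Set.Icc (0 : ℝ) 1)) :
    (1 - (1 + z) * ((u : ℝ) : ℂ)) ≠ 0 := by
  obtain ⟨u, hu0, hu1⟩ := u
  intro h
  rcases hu0.eq_or_lt with h0 | h0
  · subst h0; simp at h
  · have h2 := aux_ne hz (t := (1 - u) / u) (div_nonneg (by linarith) h0.le)
    apply h2
    have : (u : ℂ) ≠ 0 := by exact_mod_cast h0.ne'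
    push_cast
    field_simp
    simp only at h
    linear_combination h

lemma cK_cont {z : ℂ} (hz : z ∈ offRplus) : Continuous (cK z) := by
  unfold cK
  refine Continuous.mul (by fun_prop) (Continuous.inv₀ (by fun_prop) (cK_den hz))

lemma cK_uOf {z : ℂ} (t : ℝ) (ht : 0 ≤ t) : cK z (uOf t ht) = ((t : ℂ) - z)⁻¹ := by
  have : (1 + (t : ℂ)) ≠ 0 := by
    have : (1 + t) ≠ 0 := by positivity
    exact_mod_cast this
  simp only [cK, uOf]
  push_cast
  rw [← mul_inv]
  congr 1
  field_simp
  ring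

lemma aux_bound {z : ℂ} (hz : z ∈ offRplus) : ∃ B : ℝ, ∀ t : ℝ, 0 ≤ t → ‖((t : ℂ) - z)⁻¹‖ ≤ B := by
  obtain ⟨B, hB⟩ := (isCompact_range (cK_cont hz)).isBounded.exists_norm_le
  exact ⟨B, fun t ht => by rw [← cK_uOf t ht]; exact hB _ ⟨_, rfl⟩⟩

lemma aux_cont_inv (z : ℂ) : Measurable fun t : ℝ => ((t : ℂ) - z)⁻¹ := by
  fun_prop

lemma aux_integrable {μ : Measure ℝ} [IsProbabilityMeasure μ] (h0 : μ (Set.Iio 0) = 0) {z : ℂ}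
    (hz : z ∈ offRplus) : Integrable (fun t : ℝ => ((t : ℂ) - z)⁻¹) μ := by
  obtain ⟨B, hB⟩ := aux_bound hz
  refine Integrable.of_bound (aux_cont_inv z).aestronglyMeasurable B ?_
  have : ∀ᵐ t ∂μ, t ∉ Set.Iio (0 : ℝ) := measure_eq_zero_iff_ae_notMem.mp h0
  filter_upwards [this] with t ht
  exact hB t (not_lt.mp ht)

lemma aux_stieltjes_ne {μ : Measure ℝ} [IsProbabilityMeasure μ] (h0 : μ (Set.Iio 0) = 0) {z : ℂ}
    (hz : z ∈ offRplus) : ∫ t, ((t : ℂ) - z)⁻¹ ∂μ ≠ 0 := by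
  have hc : ∃ c : ℂ, ∀ t : ℝ, 0 ≤ t → 0 < (c * ((t : ℂ) - z)⁻¹).re := by
    have hn : ∀ t : ℝ, 0 ≤ t → 0 < Complex.normSq ((t : ℂ) - z) := fun t ht =>
      Complex.normSq_pos.mpr (aux_ne hz ht)
    rcases lt_trichotomy z.im 0 with h | h | h
    · refine ⟨Complex.I, fun t ht => ?_⟩
      simp [Complex.inv_im]
      exact div_neg_of_neg_of_pos h (hn t ht)
    · have hr : z.re < 0 := by
        by_contra h'
        exact hz ⟨h, not_lt.mp h'⟩
      refine ⟨1, fun t ht => ?_⟩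
      simp [Complex.inv_re]
      exact div_pos (by linarith) (hn t ht)
    · refine ⟨-Complex.I, fun t ht => ?_⟩
      simp [Complex.inv_im]
      exact div_pos h (hn t ht)
  obtain ⟨c, hc⟩ := hc
  intro hzero
  have hi := (aux_integrable h0 hz).const_mul c
  have h1 : ∫ t, (c * ((t : ℂ) - z)⁻¹).re ∂μ = 0 := by
    have := integral_re hi
    simp only [RCLike.re_eq_complex_re] at this
    rw [this, integral_const_mul, hzero]; simp
  have hae : ∀ᵐ t ∂μ, t ∉ Set.Iio (0 : ℝ) := measure_eq_zero_iff_ae_notMem.mp h0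
  have h2 : (fun t : ℝ => (c * ((t : ℂ) - z)⁻¹).re) =ᵐ[μ] 0 := by
    refine (integral_eq_zero_iff_of_nonneg_ae ?_ hi.re).mp h1
    filter_upwards [hae] with t ht
    exact (hc t (not_lt.mp ht)).le
  obtain ⟨t, ht1, ht2⟩ := (h2.and hae).exists
  exact (hc t (not_lt.mp ht2)).ne' ht1

lemma aux_integral_simple (μ : Measure ℝ) [IsProbabilityMeasure μ] (φ : SimpleFunc ℝ ℝ)
    (g : ℝ → ℂ) : ∫ t, g (φ t) ∂μ = ∑ r : φ.range, (μ.real (φ ⁻¹' {(r : ℝ)}) : ℂ) * g r := by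
  classical
  have h : ∀ t, g (φ t) = ∑ r : φ.range, (φ ⁻¹' {(r : ℝ)}).indicator (fun _ => g r) t := by
    intro t
    rw [Finset.sum_eq_single (⟨φ t, φ.mem_range_self t⟩ : φ.range)]
    · simp
    · intro b _ hb
      apply Set.indicator_of_notMem
      intro h
      apply hb
      ext
      exact h.symm
    · simp
  simp_rw [h]
  rw [integral_finsetSum]
  · refine Finset.sum_congr rfl fun r _ => ?_
    rw [integral_indicator_const _ (φ.measurableSet_fiber _), Complex.real_smul]
  · intro r _
    exact (integrable_const _).indicator (φ.measurableSet_fiber _)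

lemma aux_discr {N : ℕ} (μ : Fin N → Measure ℝ) (hμ : ∀ i, IsProbabilityMeasure (μ i))
    (φ : SimpleFunc ℝ ℝ) : ∃ E : Matrix (Fin N × φ.range) (Fin N) ℂ, Eᴴ * E = 1 ∧
      ∀ g : ℝ → ℂ, Eᴴ * Matrix.diagonal (fun a : Fin N × φ.range => g (a.2 : ℝ)) * E
        = Matrix.diagonal (fun i => ∫ t, g (φ t) ∂μ i) := by
  classical
  let E : Matrix (Fin N × φ.range) (Fin N) ℂ := Matrix.of fun a j =>
    if a.1 = j then ((Real.sqrt ((μ j).real (φ ⁻¹' {(a.2 : ℝ)})) : ℝ) : ℂ) else 0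
  have key : ∀ g : ℝ → ℂ, Eᴴ * Matrix.diagonal (fun a : Fin N × φ.range => g (a.2 : ℝ)) * E
        = Matrix.diagonal (fun i => ∫ t, g (φ t) ∂μ i) := by
    intro g
    ext i j
    have := hμ i
    rw [Matrix.mul_apply, Fintype.sum_prod_type]
    simp only [Matrix.mul_diagonal, Matrix.conjTranspose_apply, E, Matrix.of_apply]
    rw [Finset.sum_eq_single i]
    · by_cases hij : i = j
      · subst hij
        rw [Matrix.diagonal_apply_eq, aux_integral_simple]
        refine Finset.sum_congr rfl fun r _ => ?_
        have h1 := Real.mul_self_sqrt (measureReal_nonneg (μ := μ i) (s := φ ⁻¹' {(r : ℝ)}))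
        simp only [if_true]
        have h4 : ∀ x : ℝ, star (x : ℂ) = (x : ℂ) := fun x => Complex.conj_ofReal _
        rw [h4, mul_right_comm, ← Complex.ofReal_mul, h1]
      · rw [Matrix.diagonal_apply_ne _ hij]
        simp [hij]
    · intro b _ hb
      simp [hb]
    · simp
  refine ⟨E, ?_, key⟩
  have := key (fun _ => 1)
  simp only [Matrix.diagonal_one, Matrix.mul_one] at this
  rw [this]
  have h : ∀ i, ∫ _, (1 : ℂ) ∂μ i = 1 := fun i => by have := hμ i; simp
  simp [h]

/-- nonnegative simple functions converging to the identity on `ℝ₊` -/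
def phiK (k : ℕ) : SimpleFunc ℝ ℝ :=
  SimpleFunc.approxOn id measurable_id (Set.Ici (0 : ℝ)) 0 (by simp) k

lemma phiK_nonneg (k : ℕ) (t : ℝ) : 0 ≤ phiK k t :=
  SimpleFunc.approxOn_mem measurable_id (by simp) k t

lemma phiK_tendsto {t : ℝ} (ht : 0 ≤ t) : Tendsto (fun k => phiK k t) atTop (𝓝 t) :=
  SimpleFunc.tendsto_approxOn measurable_id (by simp) (by simpa using ht)

lemma phiK_int_tendsto {μ : Measure ℝ} (hμ : IsProbabilityMeasure μ) (h0 : μ (Set.Iio 0) = 0)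
    {z : ℂ} (hz : z ∈ offRplus) :
    Tendsto (fun k => ∫ t, ((phiK k t : ℂ) - z)⁻¹ ∂μ) atTop (𝓝 (∫ t, ((t : ℂ) - z)⁻¹ ∂μ)) := by
  obtain ⟨B, hB⟩ := aux_bound hz
  refine tendsto_integral_of_dominated_convergence (fun _ => B) ?_ (integrable_const _) ?_ ?_
  · intro k
    exact ((aux_cont_inv z).comp (phiK k).measurable).aestronglyMeasurable
  · intro k
    exact Eventually.of_forall fun t => hB _ (phiK_nonneg k t)
  · have hae : ∀ᵐ t ∂μ, t ∉ Set.Iio (0 : ℝ) := measure_eq_zero_iff_ae_notMem.mp h0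
    filter_upwards [hae] with t ht
    have ht' : 0 ≤ t := not_lt.mp ht
    refine Tendsto.inv₀ ?_ (aux_ne hz ht')
    exact (((Complex.continuous_ofReal.tendsto _).comp (phiK_tendsto ht')).sub_const z)

lemma aux_step {N n : ℕ} (hN : 0 < N) (C : Matrix (Fin N) (Fin n) ℂ)
    (μ : Fin N → Measure ℝ) (hμ : ∀ i, IsProbabilityMeasure (μ i))
    (μt : Fin n → Measure ℝ) (hμt : ∀ i, IsProbabilityMeasure (μt i)) (k : ℕ) :
    ∃ σ : ProbabilityMeasure (KSp N), ∀ z ∈ offRplus,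
      ∀ (U Γ : Matrix (Fin N) (Fin N) ℂ) (Γt : Matrix (Fin n) (Fin n) ℂ),
        U = Matrix.of (fun i j => (N : ℂ) * ∫ p, cK z p.1 * ((p.2 i : ℂ) * star (p.2 j : ℂ))
          ∂(σ : Measure (KSp N))) →
        Γ = Matrix.diagonal (fun i => ∫ t, ((phiK k t : ℂ) - z)⁻¹ ∂μ i) →
        Γt = Matrix.diagonal (fun i => ∫ t, ((phiK k t : ℂ) - z)⁻¹ ∂μt i) →
        U = Γ + z • (Γ * C * Γt * Cᴴ * U) := by
  classical
  obtain ⟨E, hE, hE'⟩ := aux_discr μ hμ (phiK k)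
  obtain ⟨G, hG, hG'⟩ := aux_discr μt hμt (phiK k)
  have hr : ∀ r : (phiK k).range, 0 ≤ (r : ℝ) := by
    rintro ⟨r, hr⟩
    obtain ⟨t, rfl⟩ := SimpleFunc.mem_range.mp hr
    exact phiK_nonneg k t
  obtain ⟨lam, V, hlam, hV, h⟩ := aux_finite_level C (fun a : Fin N × (phiK k).range => (a.2 : ℝ))
    (fun a => hr _) (fun a : Fin n × (phiK k).range => (a.2 : ℝ)) (fun a => hr _) E hE G hG
  obtain ⟨σ, hσ⟩ := aux_measure_of_finite hN lam hlam V hV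
  refine ⟨σ, fun z hz U Γ Γt hU hΓ hΓt => h z hz U Γ Γt ?_ ?_ ?_⟩
  · rw [hU]
    ext i j
    have hN0 : (N : ℂ) ≠ 0 := by exact_mod_cast hN.ne'
    rw [Matrix.of_apply, hσ (cK z) i j, mul_inv_cancel_left₀ hN0, Matrix.mul_apply]
    refine Finset.sum_congr rfl fun a _ => ?_
    rw [Matrix.mul_diagonal, Matrix.conjTranspose_apply, cK_uOf]
    ring
  · rw [hΓ, ← hE' (fun r => ((r : ℂ) - z)⁻¹)]
  · rw [hΓt, ← hG' (fun r => ((r : ℂ) - z)⁻¹)]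

lemma aux_cont_vec {N : ℕ} (i j : Fin N) :
    Continuous fun p : KSp N => ((p.2 i : ℂ) * star (p.2 j : ℂ)) := by
  fun_prop

lemma aux_limit {N n : ℕ} (hN : 0 < N) (C : Matrix (Fin N) (Fin n) ℂ)
    (μ : Fin N → Measure ℝ) (hμ : ∀ i, IsProbabilityMeasure (μ i)) (hμ0 : ∀ i, μ i (Set.Iio 0) = 0)
    (μt : Fin n → Measure ℝ) (hμt : ∀ i, IsProbabilityMeasure (μt i))
    (hμt0 : ∀ i, μt i (Set.Iio 0) = 0) :
    ∃ σ : ProbabilityMeasure (KSp N), ∀ z ∈ offRplus,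
      ∀ (U Γ : Matrix (Fin N) (Fin N) ℂ) (Γt : Matrix (Fin n) (Fin n) ℂ),
        U = Matrix.of (fun i j => (N : ℂ) * ∫ p, cK z p.1 * ((p.2 i : ℂ) * star (p.2 j : ℂ))
          ∂(σ : Measure (KSp N))) →
        Γ = Matrix.diagonal (fun i => ∫ t, ((t : ℂ) - z)⁻¹ ∂μ i) →
        Γt = Matrix.diagonal (fun i => ∫ t, ((t : ℂ) - z)⁻¹ ∂μt i) →
        U = Γ + z • (Γ * C * Γt * Cᴴ * U) := by
  choose σk hσk using fun k => aux_step hN C μ hμ μt hμt k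
  let F : Ultrafilter ℕ := hyperfilter ℕ
  have hF : (F : Filter ℕ) ≤ atTop := Nat.hyperfilter_le_atTop
  let σ := (F.map σk).lim
  have hσ : Tendsto σk F (𝓝 σ) := (F.map σk).le_nhds_lim
  rw [ProbabilityMeasure.tendsto_iff_forall_integral_rclike_tendsto ℂ] at hσ
  refine ⟨σ, fun z hz U Γ Γt hU hΓ hΓt => ?_⟩
  let Uk : ℕ → Matrix (Fin N) (Fin N) ℂ := fun k =>
    Matrix.of (fun i j => (N : ℂ) * ∫ p, cK z p.1 * ((p.2 i : ℂ) * star (p.2 j : ℂ))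
          ∂(σk k : Measure (KSp N)))
  let Γk : ℕ → Matrix (Fin N) (Fin N) ℂ := fun k =>
    Matrix.diagonal (fun i => ∫ t, ((phiK k t : ℂ) - z)⁻¹ ∂μ i)
  let Γtk : ℕ → Matrix (Fin n) (Fin n) ℂ := fun k =>
    Matrix.diagonal (fun i => ∫ t, ((phiK k t : ℂ) - z)⁻¹ ∂μt i)
  have t1 : Tendsto Uk F (𝓝 U) := by
    rw [hU]
    refine tendsto_pi_nhds.mpr fun i => tendsto_pi_nhds.mpr fun j => ?_
    refine Tendsto.const_mul _ ?_
    exact hσ (BoundedContinuousFunction.mkOfCompact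
      ⟨fun p : KSp N => cK z p.1 * ((p.2 i : ℂ) * star (p.2 j : ℂ)),
        ((cK_cont hz).comp continuous_fst).mul (aux_cont_vec i j)⟩)
  have t2 : Tendsto Γk F (𝓝 Γ) := by
    rw [hΓ]
    refine ((Continuous.matrix_diagonal continuous_id).tendsto _).comp ?_
    exact tendsto_pi_nhds.mpr fun i => (phiK_int_tendsto (hμ i) (hμ0 i) hz).mono_left hF
  have t3 : Tendsto Γtk F (𝓝 Γt) := by
    rw [hΓt]
    refine ((Continuous.matrix_diagonal continuous_id).tendsto _).comp ?_
    exact tendsto_pi_nhds.mpr fun i => (phiK_int_tendsto (hμt i) (hμt0 i) hz).mono_left hF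
  have t4 : Tendsto (fun k => Γk k + z • (Γk k * C * Γtk k * Cᴴ * Uk k)) F
      (𝓝 (Γ + z • (Γ * C * Γt * Cᴴ * U))) := by
    have hcont : Continuous fun q : Matrix (Fin N) (Fin N) ℂ × Matrix (Fin n) (Fin n) ℂ ×
      Matrix (Fin N) (Fin N) ℂ => q.1 + z • (q.1 * C * q.2.1 * Cᴴ * q.2.2) := by fun_prop
    exact (hcont.tendsto (Γ, Γt, U)).comp (t2.prodMk_nhds (t3.prodMk_nhds t1))
  refine tendsto_nhds_unique t1 (t4.congr fun k => ?_)
  exact (hσk k z hz (Uk k) (Γk k) (Γtk k) rfl rfl rfl).symm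

lemma aux_offneg {y : ℝ} (hy : 0 < y) : (-(y : ℂ)) ∈ offRplus := by
  intro h
  have := h.2
  simp at this
  linarith

lemma aux_y_tendsto (t : ℝ) (ht : 0 ≤ t) :
    Tendsto (fun k : ℕ => (((k : ℝ) + 1 : ℝ) : ℂ) * ((t : ℂ) - -(((k : ℝ) + 1 : ℝ) : ℂ))⁻¹) atTop
      (𝓝 1) := by
  have h1 : Tendsto (fun k : ℕ => (1 + t * ((k : ℝ) + 1)⁻¹)⁻¹) atTop (𝓝 1) := by
    have h2 : Tendsto (fun k : ℕ => ((k : ℝ) + 1)⁻¹) atTop (𝓝 0) := by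
      simpa using tendsto_one_div_add_atTop_nhds_zero_nat (𝕜 := ℝ)
    have h3 : Tendsto (fun k : ℕ => (1 + t * ((k : ℝ) + 1)⁻¹)) atTop (𝓝 1) := by
      simpa using (h2.const_mul t).const_add 1
    simpa using h3.inv₀ one_ne_zero
  have h4 := (Complex.continuous_ofReal.tendsto _).comp h1
  rw [Complex.ofReal_one] at h4
  refine h4.congr fun k => ?_
  have hk : (0 : ℝ) < k + 1 := by positivity
  simp only [Function.comp]
  rw [sub_neg_eq_add]
  norm_cast
  have : t + ((k : ℝ) + 1) ≠ 0 := by positivity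
  have h5 : (k : ℝ) + 1 + t ≠ 0 := by positivity
  push_cast
  field_simp
  ring

lemma aux_y_bound (y t : ℝ) (hy : 0 < y) (ht : 0 ≤ t) :
    ‖(y : ℂ) * ((t : ℂ) - -(y : ℂ))⁻¹‖ ≤ 1 := by
  rw [sub_neg_eq_add, ← Complex.ofReal_add, ← Complex.ofReal_inv, ← Complex.ofReal_mul,
    Complex.norm_real, Real.norm_of_nonneg (by positivity), ← div_eq_mul_inv]
  exact div_le_one_of_le₀ (by linarith) (by positivity)

lemma aux_stieltjes_mass {μ : Measure ℝ} (hμ : IsProbabilityMeasure μ) (h0 : μ (Set.Iio 0) = 0) :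
    Tendsto (fun k : ℕ => (((k : ℝ) + 1 : ℝ) : ℂ) *
      ∫ t, ((t : ℂ) - -(((k : ℝ) + 1 : ℝ) : ℂ))⁻¹ ∂μ) atTop (𝓝 1) := by
  have hae : ∀ᵐ t ∂μ, t ∉ Set.Iio (0 : ℝ) := measure_eq_zero_iff_ae_notMem.mp h0
  have h : Tendsto (fun k : ℕ => ∫ t, (((k : ℝ) + 1 : ℝ) : ℂ) *
      ((t : ℂ) - -(((k : ℝ) + 1 : ℝ) : ℂ))⁻¹ ∂μ) atTop (𝓝 (∫ _, (1 : ℂ) ∂μ)) := by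
    refine tendsto_integral_of_dominated_convergence (fun _ => 1) ?_ (integrable_const _) ?_ ?_
    · intro k
      exact ((aux_cont_inv _).const_mul _).aestronglyMeasurable
    · intro k
      filter_upwards [hae] with t ht
      exact aux_y_bound _ _ (by positivity) (not_lt.mp ht)
    · filter_upwards [hae] with t ht
      exact aux_y_tendsto t (not_lt.mp ht)
  simpa [integral_const_mul] using h

lemma u_cases (u : ↥(Set.Icc (0 : ℝ) 1)) :
    (u : ℝ) = 0 ∨ ∃ (ht : 0 ≤ (u : ℝ)⁻¹ - 1), 0 < (u : ℝ) ∧ u = uOf ((u : ℝ)⁻¹ - 1) ht := by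
  obtain ⟨u, hu0, hu1⟩ := u
  rcases hu0.eq_or_lt with h0 | h0
  · left; exact h0.symm
  · right
    have := (one_le_inv₀ h0).mpr hu1
    refine ⟨by simpa using this, h0, ?_⟩
    ext
    simp [uOf]

lemma cK_zero {z : ℂ} {u : ↥(Set.Icc (0 : ℝ) 1)} (h : (u : ℝ) = 0) : cK z u = 0 := by
  simp [cK, h]

/-- `1/u - 1` coordinate -/
def tMap {N : ℕ} (p : KSp N) : ℝ × VecD N := ((p.1 : ℝ)⁻¹ - 1, p.2)

lemma tMap_meas {N : ℕ} : Measurable (tMap : KSp N → ℝ × VecD N) := by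
  unfold tMap
  fun_prop

lemma aux_vec_norm {N : ℕ} (v : VecD N) (i j : Fin N) : ‖(v i : ℂ) * star (v j : ℂ)‖ ≤ 1 := by
  rw [norm_mul, norm_star]
  have h1 := mem_closedBall_zero_iff.mp (v i).2
  have h2 := mem_closedBall_zero_iff.mp (v j).2
  exact mul_le_one₀ h1 (norm_nonneg _) h2

set_option maxHeartbeats 1000000 in
lemma aux_vecrep {N n : ℕ} (hN : 0 < N) (A : Matrix (Fin N) (Fin n) ℝ)
    (γ : Fin N → ℂ → ℂ) (γt : Fin n → ℂ → ℂ)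
    (hγ : ∀ i, IsStieltjesPM (γ i)) (hγt : ∀ j, IsStieltjesPM (γt j)) :
    ∃ σ : Measure (ℝ × VecD N), IsFiniteMeasure σ ∧ (∀ᵐ p ∂σ, 0 ≤ p.1) ∧
      (∀ i j, ∫ p, ((p.2 i : ℂ) * star (p.2 j : ℂ)) ∂σ = (1 : Matrix (Fin N) (Fin N) ℂ) i j) ∧
      ∀ z ∈ offRplus, ∀ i j, Tmat A γ γt z i j
        = ∫ p, ((p.1 : ℂ) - z)⁻¹ * ((p.2 i : ℂ) * star (p.2 j : ℂ)) ∂σ := by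
  choose μ hμ hμ0 hμz using hγ
  choose μt hμt hμt0 hμtz using hγt
  set C : Matrix (Fin N) (Fin n) ℂ := A.map Complex.ofReal with hC
  have hCH : Cᴴ = Cᵀ := by
    ext i j
    simp [hC]
  obtain ⟨σ, hσ⟩ := aux_limit hN C μ hμ hμ0 μt hμt hμt0
  let S : Set (KSp N) := {p | 0 < (p.1 : ℝ)}
  have hS : MeasurableSet S := by
    apply measurableSet_lt measurable_const
    fun_prop
  let U : ℂ → Matrix (Fin N) (Fin N) ℂ := fun z => Matrix.of (fun i j => (N : ℂ) *
    ∫ p, cK z p.1 * ((p.2 i : ℂ) * star (p.2 j : ℂ)) ∂(σ : Measure (KSp N)))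
  let Γ : ℂ → Matrix (Fin N) (Fin N) ℂ := fun z =>
    Matrix.diagonal (fun i => ∫ t, ((t : ℂ) - z)⁻¹ ∂μ i)
  let Γt : ℂ → Matrix (Fin n) (Fin n) ℂ := fun z =>
    Matrix.diagonal (fun i => ∫ t, ((t : ℂ) - z)⁻¹ ∂μt i)
  have hU : ∀ z ∈ offRplus, U z = Γ z + z • (Γ z * C * Γt z * Cᴴ * U z) := fun z hz =>
    hσ z hz (U z) (Γ z) (Γt z) rfl rfl rfl
  let M : Matrix (Fin N) (Fin N) ℂ := Matrix.of (fun i j => (N : ℂ) *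
    ∫ p in S, ((p.2 i : ℂ) * star (p.2 j : ℂ)) ∂(σ : Measure (KSp N)))
  have hM : M = 1 := by
    let y : ℕ → ℂ := fun k => (((k : ℝ) + 1 : ℝ) : ℂ)
    have t1 : Tendsto (fun k => y k • U (-(y k))) atTop (𝓝 M) := by
      refine tendsto_pi_nhds.mpr fun i => tendsto_pi_nhds.mpr fun j => ?_
      have : Tendsto (fun k => ∫ p, y k * cK (-(y k)) p.1 * ((p.2 i : ℂ) * star (p.2 j : ℂ))
          ∂(σ : Measure (KSp N))) atTop
          (𝓝 (∫ p, S.indicator (fun p => ((p.2 i : ℂ) * star (p.2 j : ℂ))) p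
            ∂(σ : Measure (KSp N)))) := by
        refine tendsto_integral_of_dominated_convergence (fun _ => 1) ?_ (integrable_const _) ?_ ?_
        · intro k
          have h1 := cK_cont (aux_offneg (y := (k : ℝ) + 1) (by positivity))
          exact (((h1.comp continuous_fst).const_mul (y k)).mul
            (aux_cont_vec i j)).aestronglyMeasurable
        · intro k
          refine Eventually.of_forall fun p => ?_
          rw [norm_mul]
          refine mul_le_one₀ ?_ (norm_nonneg _) (aux_vec_norm _ _ _)
          rcases u_cases p.1 with h | ⟨ht, h, h'⟩
          · rw [cK_zero h]; simp
          · rw [h', cK_uOf]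
            exact aux_y_bound _ _ (by positivity) ht
        · refine Eventually.of_forall fun p => ?_
          rcases u_cases p.1 with h | ⟨ht, h, h'⟩
          · have hp : p ∉ S := fun hp => (ne_of_gt hp) h
            rw [Set.indicator_of_notMem hp]
            simp [cK_zero h]
          · have hp : p ∈ S := h
            rw [Set.indicator_of_mem hp]
            have h2 := (aux_y_tendsto _ ht).mul_const ((p.2 i : ℂ) * star (p.2 j : ℂ))
            rw [one_mul] at h2
            rw [h']
            simp_rw [cK_uOf]
            exact h2
      rw [integral_indicator hS] at this
      have h3 := this.const_mul (N : ℂ)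
      refine h3.congr fun k => ?_
      simp only [U, Matrix.smul_apply, Matrix.of_apply, smul_eq_mul, mul_assoc, integral_const_mul]
      ring
    have t2 : Tendsto (fun k => y k • Γ (-(y k))) atTop (𝓝 1) := by
      rw [← Matrix.diagonal_one]
      have h1 : ∀ k, y k • Γ (-(y k)) = Matrix.diagonal
        (fun i => y k * ∫ t, ((t : ℂ) - -(y k))⁻¹ ∂μ i) := fun k => by
          simp only [Γ]; rw [← Matrix.diagonal_smul]; rfl
      simp_rw [h1]
      refine ((Continuous.matrix_diagonal continuous_id).tendsto _).comp ?_
      exact tendsto_pi_nhds.mpr fun i => aux_stieltjes_mass (hμ i) (hμ0 i)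
    have t3 : Tendsto (fun k => Γt (-(y k))) atTop (𝓝 0) := by
      rw [← Matrix.diagonal_zero]
      refine ((Continuous.matrix_diagonal continuous_id).tendsto _).comp ?_
      refine tendsto_pi_nhds.mpr fun i => ?_
      have h2 : Tendsto (fun k : ℕ => (y k)⁻¹) atTop (𝓝 0) := by
        have := tendsto_one_div_add_atTop_nhds_zero_nat (𝕜 := ℂ)
        simpa [y] using this
      have h3 := h2.mul (aux_stieltjes_mass (hμt i) (hμt0 i))
      rw [zero_mul] at h3
      refine h3.congr fun k => ?_
      have hk : y k ≠ 0 := by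
        have : ((k : ℝ) + 1) ≠ 0 := by positivity
        exact Complex.ofReal_ne_zero.mpr this
      exact inv_mul_cancel_left₀ hk _
    have t4 : Tendsto (fun k => y k • Γ (-(y k)) - (y k • Γ (-(y k))) * C * Γt (-(y k)) * Cᴴ *
        (y k • U (-(y k)))) atTop
        (𝓝 ((1 : Matrix (Fin N) (Fin N) ℂ) - (1 : Matrix (Fin N) (Fin N) ℂ) * C * (0 : Matrix (Fin n) (Fin n) ℂ) * Cᴴ * M)) := by
      have hcont : Continuous fun q : Matrix (Fin N) (Fin N) ℂ × Matrix (Fin n) (Fin n) ℂ ×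
        Matrix (Fin N) (Fin N) ℂ => q.1 - (q.1 * C * q.2.1 * Cᴴ * q.2.2) := by fun_prop
      exact (hcont.tendsto (1, 0, M)).comp (t2.prodMk_nhds (t3.prodMk_nhds t1))
    have t5 : M = (1 : Matrix (Fin N) (Fin N) ℂ) - (1 : Matrix (Fin N) (Fin N) ℂ) * C * (0 : Matrix (Fin n) (Fin n) ℂ) * Cᴴ * M := by
      refine tendsto_nhds_unique t1 (t4.congr fun k => ?_)
      have e := hU (-(y k)) (aux_offneg (y := (k : ℝ) + 1) (by positivity))
      nth_rewrite 2 [e]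
      simp only [Matrix.smul_mul, Matrix.mul_smul, smul_add, neg_smul, smul_neg, sub_eq_add_neg]
    rw [t5]; simp
  have hNN : (N : ENNReal) ≠ ⊤ := ENNReal.natCast_ne_top N
  refine ⟨(N : ENNReal) • ((σ : Measure (KSp N)).restrict S).map tMap, ?_, ?_, ?_, ?_⟩
  · exact Measure.smul_finite _ hNN
  · refine Measure.ae_smul_measure ?_ _
    rw [ae_map_iff tMap_meas.aemeasurable (measurableSet_le measurable_const measurable_fst)]
    filter_upwards [ae_restrict_mem hS] with p hp
    rcases u_cases p.1 with h | ⟨ht, h, h'⟩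
    · exact absurd h (ne_of_gt hp)
    · exact ht
  · intro i j
    rw [integral_smul_measure, integral_map tMap_meas.aemeasurable]
    · rw [← hM]
      simp [M, tMap]
    · apply Measurable.aestronglyMeasurable
      fun_prop
  · intro z hz i j
    rw [integral_smul_measure, integral_map tMap_meas.aemeasurable]
    · have hT : Tmat A γ γt z = U z := by
        have hd : (Matrix.diagonal fun i => γ i z) = Γ z := by
          simp only [Γ]; congr 1; funext i; exact hμz i z hz
        have hdt : (Matrix.diagonal fun i => γt i z) = Γt z := by
          simp only [Γt]; congr 1; funext i; exact hμtz i z hz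
        unfold Tmat
        rw [hd, hdt, ← hC, ← hCH]
        apply Matrix.inv_eq_right_inv
        have hdet : IsUnit (Γ z).det := by
          simp only [Γ]
          rw [Matrix.det_diagonal, isUnit_iff_ne_zero, Finset.prod_ne_zero_iff]
          intro i _
          have := hμ i
          exact aux_stieltjes_ne (hμ0 i) hz
        have h1 : (Γ z)⁻¹ * U z = 1 + z • (C * Γt z * Cᴴ * U z) := by
          nth_rewrite 1 [hU z hz]
          rw [Matrix.mul_add, Matrix.nonsing_inv_mul _ hdet, Matrix.mul_smul]
          simp only [Matrix.mul_assoc]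
          rw [← Matrix.mul_assoc, Matrix.nonsing_inv_mul _ hdet, Matrix.one_mul]
        rw [Matrix.sub_mul, h1, Matrix.smul_mul]
        simp
      rw [hT]
      simp only [U, Matrix.of_apply, ENNReal.toReal_natCast, tMap]
      rw [← setIntegral_eq_integral_of_forall_compl_eq_zero (s := S)]
      · rw [← Complex.coe_smul, smul_eq_mul, Complex.ofReal_natCast]
        congr 1
        refine setIntegral_congr_fun hS fun p hp => ?_
        rcases u_cases p.1 with h | ⟨ht, h, h'⟩
        · exact absurd h (ne_of_gt hp)
        · rw [← cK_uOf _ ht, ← h']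
      · intro p hp
        rcases u_cases p.1 with h | ⟨ht, h, h'⟩
        · rw [cK_zero h, zero_mul]
        · exact absurd h hp
    · apply Measurable.aestronglyMeasurable
      fun_prop

lemma aux_psd_int {N : ℕ} {Ω : Type*} [MeasurableSpace Ω] (ν : Measure Ω) (h : Ω → ℝ)
    (v : Ω → Fin N → ℂ) (hh : ∀ᵐ p ∂ν, 0 ≤ h p)
    (hIntg : ∀ i j, Integrable (fun p => (h p : ℂ) * (v p i * star (v p j))) ν) :
    (Matrix.of fun i j => ∫ p, (h p : ℂ) * (v p i * star (v p j)) ∂ν).PosSemidef := by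
  refine Matrix.PosSemidef.of_dotProduct_mulVec_nonneg ?_ ?_
  · ext i j
    rw [Matrix.conjTranspose_apply, Matrix.of_apply, Matrix.of_apply]
    have := integral_conj (μ := ν) (f := fun p => (h p : ℂ) * (v p j * star (v p i)))
    rw [← starRingEnd_apply, ← this]
    congr 1
    funext p
    simp only [map_mul, Complex.conj_ofReal]
    simp only [starRingEnd_apply, star_star]
    ring
  · intro x
    have h1 : star x ⬝ᵥ ((Matrix.of fun i j => ∫ p, (h p : ℂ) * (v p i * star (v p j)) ∂ν) *ᵥ x)
        = ∫ p, ((h p * ‖∑ i, star (x i) * v p i‖ ^ 2 : ℝ) : ℂ) ∂ν := by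
      have h2 : ∀ p, ((h p * ‖∑ i, star (x i) * v p i‖ ^ 2 : ℝ) : ℂ)
          = ∑ i, ∑ j, star (x i) * x j * ((h p : ℂ) * (v p i * star (v p j))) := by
        intro p
        push_cast
        rw [← Complex.mul_conj', map_sum, Finset.sum_mul_sum, Finset.mul_sum]
        refine Finset.sum_congr rfl fun i _ => ?_
        rw [Finset.mul_sum]
        refine Finset.sum_congr rfl fun j _ => ?_
        simp only [map_mul, starRingEnd_apply, star_star]
        ring
      simp_rw [h2]
      rw [integral_finsetSum _ fun i _ => integrable_finsetSum _ fun j _ =>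
        (hIntg i j).const_mul _]
      simp only [dotProduct, Matrix.mulVec, Matrix.of_apply, Pi.star_apply]
      refine Finset.sum_congr rfl fun i _ => ?_
      rw [integral_finsetSum _ fun j _ => (hIntg i j).const_mul _, Finset.mul_sum]
      refine Finset.sum_congr rfl fun j _ => ?_
      rw [integral_const_mul]
      ring
    rw [h1, integral_complex_ofReal]
    rw [Complex.zero_le_real]
    refine integral_nonneg_of_ae ?_
    filter_upwards [hh] with p hp
    exact mul_nonneg hp (by positivity)

section final

variable {N : ℕ} {σ : Measure (ℝ × VecD N)}

lemma aux_vec_meas (i j : Fin N) :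
    Measurable fun v : VecD N => ((v i : ℂ) * star (v j : ℂ)) := by
  fun_prop

lemma aux_int_mul [IsFiniteMeasure σ] (hpos : ∀ᵐ p ∂σ, 0 ≤ p.1) (g : ℝ → ℂ) (hg : Measurable g)
    (B : ℝ) (hB : ∀ t, 0 ≤ t → ‖g t‖ ≤ B) (i j : Fin N) :
    Integrable (fun p : ℝ × VecD N => g p.1 * ((p.2 i : ℂ) * star (p.2 j : ℂ))) σ := by
  refine Integrable.of_bound
    ((hg.comp measurable_fst).mul ((aux_vec_meas i j).comp measurable_snd)).aestronglyMeasurable B ?_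
  filter_upwards [hpos] with p hp
  rw [norm_mul]
  have h1 := hB _ hp
  have h2 := aux_vec_norm p.2 i j
  calc _ ≤ B * 1 := mul_le_mul h1 h2 (norm_nonneg _) ((norm_nonneg _).trans h1)
    _ = B := mul_one B

lemma aux_matIm_psd [IsFiniteMeasure σ] (hpos : ∀ᵐ p ∂σ, 0 ≤ p.1) (g : ℝ → ℂ) (hg : Measurable g)
    (B : ℝ) (hB : ∀ t, 0 ≤ t → ‖g t‖ ≤ B) (him : ∀ t, 0 ≤ t → 0 ≤ (g t).im)
    (T : Matrix (Fin N) (Fin N) ℂ)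
    (hT : ∀ i j, T i j = ∫ p, g p.1 * ((p.2 i : ℂ) * star (p.2 j : ℂ)) ∂σ) :
    (matIm T).PosSemidef := by
  have hgm : Measurable fun t => (((g t).im : ℝ) : ℂ) := by fun_prop
  have h := aux_psd_int σ (fun p => (g p.1).im) (fun p i => (p.2 i : ℂ))
    (by filter_upwards [hpos] with p hp using him _ hp)
    (fun i j => aux_int_mul hpos (fun t => (((g t).im : ℝ) : ℂ)) hgm B
      (fun t ht => by
        rw [Complex.norm_real]; exact (Complex.abs_im_le_norm _).trans (hB t ht)) i j)
  convert h using 1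
  ext i j
  rw [Matrix.of_apply, matIm, Matrix.smul_apply, Matrix.sub_apply, Matrix.conjTranspose_apply,
    hT, hT, ← starRingEnd_apply, ← integral_conj, ← integral_sub, smul_eq_mul, ← integral_const_mul]
  · congr 1
    funext p
    have h1 : (((g p.1).im : ℝ) : ℂ) = (2 * Complex.I)⁻¹ * (g p.1 - (starRingEnd ℂ) (g p.1)) := by
      rw [Complex.sub_conj]
      have := Complex.I_ne_zero
      field_simp
      push_cast
      ring
    rw [h1]
    simp only [map_mul, starRingEnd_apply, star_star]
    ring
  · exact aux_int_mul hpos g hg B hB i j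
  · have := aux_int_mul hpos (fun t => (starRingEnd ℂ) (g t)) (by fun_prop) B
      (fun t ht => by rw [RCLike.norm_conj]; exact hB t ht) i j
    refine this.congr (Eventually.of_forall fun p => ?_)
    simp only [map_mul, starRingEnd_apply, star_star]
    ring

lemma aux_off_of_im {z : ℂ} (hz : 0 < z.im) : z ∈ offRplus := fun h => hz.ne' h.1

lemma aux_part1 [IsFiniteMeasure σ] (hpos : ∀ᵐ p ∂σ, 0 ≤ p.1) (T : ℂ → Matrix (Fin N) (Fin N) ℂ)
    (hT : ∀ z ∈ offRplus, ∀ i j, T z i j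
        = ∫ p, ((p.1 : ℂ) - z)⁻¹ * ((p.2 i : ℂ) * star (p.2 j : ℂ)) ∂σ) (z : ℂ) (hz : 0 < z.im) :
    (matIm (T z)).PosSemidef ∧ (matIm (z • T z)).PosSemidef := by
  have hz' := aux_off_of_im hz
  obtain ⟨B, hB⟩ := aux_bound hz'
  constructor
  · refine aux_matIm_psd hpos (fun t => ((t : ℂ) - z)⁻¹) (aux_cont_inv z) B hB ?_ _ (hT z hz')
    intro t ht
    simp only [Complex.inv_im, Complex.sub_im, Complex.ofReal_im]
    exact div_nonneg (by linarith) (Complex.normSq_nonneg _)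
  · refine aux_matIm_psd hpos (fun t => z * ((t : ℂ) - z)⁻¹) ((aux_cont_inv z).const_mul z)
      (‖z‖ * B) ?_ ?_ _ ?_
    · intro t ht
      rw [norm_mul]
      exact mul_le_mul_of_nonneg_left (hB t ht) (norm_nonneg _)
    · intro t ht
      have : (z * ((t : ℂ) - z)⁻¹).im = t * z.im / Complex.normSq ((t : ℂ) - z) := by
        simp only [Complex.mul_im, Complex.inv_im, Complex.inv_re, Complex.sub_im, Complex.sub_re,
          Complex.ofReal_im, Complex.ofReal_re]
        ring
      rw [this]
      exact div_nonneg (mul_nonneg ht hz.le) (Complex.normSq_nonneg _)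
    · intro i j
      rw [Matrix.smul_apply, hT z hz', smul_eq_mul, ← integral_const_mul]
      simp only [mul_assoc]

lemma aux_part2 [IsFiniteMeasure σ] (hpos : ∀ᵐ p ∂σ, 0 ≤ p.1)
    (hone : ∀ i j, ∫ p, ((p.2 i : ℂ) * star (p.2 j : ℂ)) ∂σ = (1 : Matrix (Fin N) (Fin N) ℂ) i j)
    (T : ℂ → Matrix (Fin N) (Fin N) ℂ)
    (hT : ∀ z ∈ offRplus, ∀ i j, T z i j
        = ∫ p, ((p.1 : ℂ) - z)⁻¹ * ((p.2 i : ℂ) * star (p.2 j : ℂ)) ∂σ) :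
    HasUnitMatrixMeasureRep N T := by
  have hIntg1 : ∀ i j, Integrable (fun p : ℝ × VecD N => ((p.2 i : ℂ) * star (p.2 j : ℂ))) σ := by
    intro i j
    simpa using aux_int_mul hpos (fun _ => 1) measurable_const 1 (by simp) i j
  refine ⟨σ.fst, fun t => Matrix.of fun i j =>
    ∫ v : VecD N, ((v i : ℂ) * star (v j : ℂ)) ∂(σ.condKernel t), ?_, ?_, ?_, ?_, ?_, ?_⟩
  · rw [Measure.fst_apply measurableSet_Iio, measure_eq_zero_iff_ae_notMem]
    filter_upwards [hpos] with p hp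
    simpa using hp
  · intro i j
    exact ((aux_vec_meas i j).stronglyMeasurable.integral_kernel).measurable
  · refine Eventually.of_forall fun t => ?_
    have := aux_psd_int (σ.condKernel t) (fun _ => 1) (fun (v : VecD N) i => (v i : ℂ))
      (by simp) (fun i j => by
        refine Integrable.of_bound ((aux_vec_meas i j).const_mul _).aestronglyMeasurable 1
          (Eventually.of_forall fun v => ?_)
        simpa using aux_vec_norm v i j)
    simpa using this
  · intro i j
    exact (hIntg1 i j).integral_condKernel
  · ext i j
    rw [Matrix.of_apply, ← hone i j]
    exact Measure.integral_condKernel (hIntg1 i j)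
  · intro z hz
    obtain ⟨B, hB⟩ := aux_bound hz
    have hi := fun i j => aux_int_mul hpos (fun t => ((t : ℂ) - z)⁻¹) (aux_cont_inv z) B hB i j
    refine ⟨fun i j => ?_, ?_⟩
    · have := (hi i j).integral_condKernel
      simpa only [integral_const_mul, Matrix.of_apply] using this
    · ext i j
      rw [hT z hz, Matrix.of_apply, ← Measure.integral_condKernel (hi i j)]
      simp only [integral_const_mul, Matrix.of_apply]

lemma aux_part3 (hN : 0 < N) [IsFiniteMeasure σ] (hpos : ∀ᵐ p ∂σ, 0 ≤ p.1)
    (hone : ∀ i j, ∫ p, ((p.2 i : ℂ) * star (p.2 j : ℂ)) ∂σ = (1 : Matrix (Fin N) (Fin N) ℂ) i j)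
    (T : ℂ → Matrix (Fin N) (Fin N) ℂ)
    (hT : ∀ z ∈ offRplus, ∀ i j, T z i j
        = ∫ p, ((p.1 : ℂ) - z)⁻¹ * ((p.2 i : ℂ) * star (p.2 j : ℂ)) ∂σ) :
    IsStieltjesPM (fun z => (N : ℂ)⁻¹ * (T z).trace) := by
  have hN0 : (N : ℂ) ≠ 0 := by exact_mod_cast hN.ne'
  let w : ℝ × VecD N → ℝ := fun p => (N : ℝ)⁻¹ * ∑ i, ‖(p.2 i : ℂ)‖ ^ 2
  have hw0 : ∀ p, 0 ≤ w p := fun p => by positivity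
  have hwm : Measurable w := by fun_prop
  have hwC : ∀ p, (w p : ℂ) = (N : ℂ)⁻¹ * ∑ i, ((p.2 i : ℂ) * star (p.2 i : ℂ)) := by
    intro p
    simp only [w]
    push_cast
    congr 1
    refine Finset.sum_congr rfl fun i _ => ?_
    rw [← Complex.mul_conj']; rfl
  have key : ∀ g : ℝ → ℂ, Measurable g → ∀ B : ℝ, (∀ t, 0 ≤ t → ‖g t‖ ≤ B) →
      ∫ p, (w p : ℂ) * g p.1 ∂σ
        = (N : ℂ)⁻¹ * ∑ i, ∫ p, g p.1 * ((p.2 i : ℂ) * star (p.2 i : ℂ)) ∂σ := by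
    intro g hg B hB
    rw [← integral_finsetSum _ fun i _ => aux_int_mul hpos g hg B hB i i, ← integral_const_mul]
    congr 1
    funext p
    rw [hwC, ← Finset.mul_sum]
    ring
  have hmass : ∫ p, w p ∂σ = 1 := by
    have h1 := key (fun _ => 1) measurable_const 1 (by simp)
    simp only [mul_one, one_mul, hone, Matrix.one_apply_eq, Finset.sum_const, Finset.card_univ,
      Fintype.card_fin, nsmul_eq_mul, inv_mul_cancel₀ hN0] at h1
    rw [integral_complex_ofReal] at h1
    exact_mod_cast h1
  have hwi : Integrable w σ := by
    by_contra h
    rw [integral_undef h] at hmass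
    exact zero_ne_one hmass
  have hlin : ∫⁻ p, ENNReal.ofReal (w p) ∂σ = 1 := by
    rw [← ofReal_integral_eq_lintegral_ofReal hwi (Eventually.of_forall hw0), hmass,
      ENNReal.ofReal_one]
  let m : Measure (ℝ × VecD N) := σ.withDensity fun p => ENNReal.ofReal (w p)
  have hm : IsProbabilityMeasure m := ⟨by
    simp only [m]
    rw [withDensity_apply _ MeasurableSet.univ, Measure.restrict_univ, hlin]⟩
  refine ⟨m.map Prod.fst, Measure.isProbabilityMeasure_map measurable_fst.aemeasurable, ?_, ?_⟩
  · rw [Measure.map_apply measurable_fst measurableSet_Iio]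
    refine withDensity_absolutelyContinuous _ _ ?_
    rw [measure_eq_zero_iff_ae_notMem]
    filter_upwards [hpos] with p hp
    simpa using hp
  · intro z hz
    obtain ⟨B, hB⟩ := aux_bound hz
    rw [integral_map measurable_fst.aemeasurable (aux_cont_inv z).aestronglyMeasurable]
    simp only [m]
    rw [integral_withDensity_eq_integral_toReal_smul hwm.ennreal_ofReal
      (Eventually.of_forall fun _ => ENNReal.ofReal_lt_top)]
    have h1 := key _ (aux_cont_inv z) B hB
    simp only [ENNReal.toReal_ofReal (hw0 _), Complex.real_smul]
    rw [h1, Matrix.trace]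
    congr 1
    refine Finset.sum_congr rfl fun i _ => ?_
    rw [Matrix.diag_apply, hT z hz]

end final

lemma aux_Tt {N n : ℕ} (A : Matrix (Fin N) (Fin n) ℝ)
    (γ : Fin N → ℂ → ℂ) (γt : Fin n → ℂ → ℂ) : Ttmat A γ γt = Tmat Aᵀ γt γ := by
  funext z
  unfold Ttmat Tmat
  have h : (Aᵀ.map Complex.ofReal) = (A.map Complex.ofReal)ᵀ := rfl
  rw [h, Matrix.transpose_transpose]

/-- Proposition 5.1 part 2: `Im Υ(z) ≥ 0` and `Im (zΥ(z)) ≥ 0` on `ℂ⁺`; `Υ` and `Υ̃`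
are represented by positive matrix-valued measures on `ℝ₊` of total mass the identity,
and the normalized traces are Stieltjes transforms of probability measures on `ℝ₊`. -/
theorem stmt_6 (N n : ℕ) (hN : 0 < N) (hn : 0 < n) (A : Matrix (Fin N) (Fin n) ℝ)
    (γ : Fin N → ℂ → ℂ) (γt : Fin n → ℂ → ℂ)
    (hγ : ∀ i, IsStieltjesPM (γ i)) (hγt : ∀ j, IsStieltjesPM (γt j)) :
    (∀ z : ℂ, 0 < z.im →
      (matIm (Tmat A γ γt z)).PosSemidef ∧ (matIm (z • Tmat A γ γt z)).PosSemidef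
      ∧ (matIm (Ttmat A γ γt z)).PosSemidef ∧ (matIm (z • Ttmat A γ γt z)).PosSemidef)
    ∧ HasUnitMatrixMeasureRep N (Tmat A γ γt)
    ∧ HasUnitMatrixMeasureRep n (Ttmat A γ γt)
    ∧ IsStieltjesPM (fun z => (N : ℂ)⁻¹ * (Tmat A γ γt z).trace)
    ∧ IsStieltjesPM (fun z => (n : ℂ)⁻¹ * (Ttmat A γ γt z).trace) := by
  obtain ⟨σ, hfin, hpos, hone, hT⟩ := aux_vecrep hN A γ γt hγ hγt
  obtain ⟨σt, hfint, hpost, honet, hTt⟩ := aux_vecrep hn Aᵀ γt γ hγt hγ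
  rw [aux_Tt]
  exact ⟨fun z hz => ⟨(aux_part1 hpos _ hT z hz).1, (aux_part1 hpos _ hT z hz).2,
      (aux_part1 hpost _ hTt z hz).1, (aux_part1 hpost _ hTt z hz).2⟩,
    aux_part2 hpos hone _ hT, aux_part2 hpost honet _ hTt,
    aux_part3 hN hpos hone _ hT, aux_part3 hn hpost honet _ hTt⟩
end
end

section
/- If (ψ_i, ψ̃_j; 1 ≤ i ≤ N, 1 ≤ j ≤ n) ∈ S(ℝ+)^{N+n} and (φ_i, φ̃_j; 1 ≤ i ≤ N, 1 ≤ j ≤ n) ∈ S(ℝ+)^{N+n} are two sets of solutions to the system of N+n equations, then ψ_i = φ_i for all 1 ≤ i ≤ N and ψ̃_j = φ̃_j for all 1 ≤ j ≤ n on ℂ ∖ ℝ+. -/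
open MeasureTheory Matrix Complex Filter
open scoped Topology ComplexOrder

noncomputable section

lemma offRplus_iff (z : ℂ) : z ∈ offRplus ↔ -z ∈ Complex.slitPlane := by
  simp only [offRplus, Set.mem_ofPred_eq, Complex.mem_slitPlane_iff, Complex.neg_re, Complex.neg_im]
  constructor
  · intro h
    by_cases h0 : z.im = 0
    · left
      by_contra h1
      exact h ⟨h0, by linarith⟩
    · right
      simpa using h0
  · rintro (h | h) ⟨h1, h2⟩
    · linarith
    · exact h (by simp [h1])

lemma isOpen_offRplus : IsOpen offRplus := by
  have : offRplus = (fun z : ℂ => -z) ⁻¹' Complex.slitPlane := by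
    ext z; exact offRplus_iff z
  rw [this]
  exact Complex.isOpen_slitPlane.preimage continuous_neg

lemma isPreconnected_offRplus : IsPreconnected offRplus := by
  have : offRplus = (fun z : ℂ => -z) '' Complex.slitPlane := by
    ext z
    rw [offRplus_iff]
    constructor
    · intro h; exact ⟨-z, h, by simp⟩
    · rintro ⟨w, hw, rfl⟩; simpa using hw
  have hpc : IsPreconnected Complex.slitPlane :=
    (Complex.starConvex_one_slitPlane.isPathConnected (by simp)).isConnected.isPreconnected
  rw [this]
  exact hpc.image _ continuous_neg.continuousOn

lemma ofReal_notMem (t : ℝ) (ht : 0 ≤ t) : (t : ℂ) ∉ offRplus := by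
  simp [offRplus, ht]

lemma IsStieltjesPM.differentiableOn {f : ℂ → ℂ} (hf : IsStieltjesPM f) :
    DifferentiableOn ℂ f offRplus := by
  obtain ⟨μ, hμ, hμ0, hfz⟩ := hf
  have hae : ∀ᵐ t ∂μ, (0:ℝ) ≤ t := by
    rw [ae_iff]
    convert hμ0 using 2
    ext t; simp
  have key : DifferentiableOn ℂ (fun z => ∫ t, ((t : ℂ) - z)⁻¹ ∂μ) offRplus := by
    intro z0 hz0
    obtain ⟨r, hr, hball⟩ := Metric.isOpen_iff.1 isOpen_offRplus z0 hz0
    have hlow : ∀ t : ℝ, 0 ≤ t → ∀ z ∈ Metric.ball z0 (r/2), r/2 ≤ ‖(t:ℂ) - z‖ := by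
      intro t ht z hz
      by_contra hlt
      push Not at hlt
      apply ofReal_notMem t ht
      apply hball
      rw [Metric.mem_ball] at hz ⊢
      have h1 : dist (t:ℂ) z < r/2 := by rwa [dist_eq_norm]
      linarith [dist_triangle (t:ℂ) z z0]
    have hmeas : ∀ z : ℂ, AEStronglyMeasurable (fun t : ℝ => ((t : ℂ) - z)⁻¹) μ := by
      intro z
      exact (by fun_prop : Measurable (fun t : ℝ => ((t : ℂ) - z)⁻¹)).aestronglyMeasurable
    have h := hasDerivAt_integral_of_dominated_loc_of_deriv_le (μ := μ) (𝕜 := ℂ)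
      (F := fun z t => ((t : ℂ) - z)⁻¹) (F' := fun z (t:ℝ) => (((t : ℂ) - z)^2)⁻¹)
      (x₀ := z0) (s := Metric.ball z0 (r/2)) (bound := fun _ => ((r/2)^2)⁻¹)
      (Metric.ball_mem_nhds _ (by positivity))
      (Filter.Eventually.of_forall hmeas)
      (by
        refine Integrable.of_bound (hmeas z0) (r/2)⁻¹ ?_
        filter_upwards [hae] with t ht
        rw [norm_inv]
        exact inv_anti₀ (by positivity) (hlow t ht z0 (Metric.mem_ball_self (by positivity))))
      (by
        exact (by fun_prop : Measurable (fun t : ℝ => (((t : ℂ) - z0)^2)⁻¹)).aestronglyMeasurable)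
      (by
        filter_upwards [hae] with t ht z hz
        rw [norm_inv, norm_pow]
        have := hlow t ht z hz
        exact inv_anti₀ (by positivity) (by gcongr))
      (integrable_const _)
      (by
        filter_upwards [hae] with t ht z hz
        have hne : (t:ℂ) - z ≠ 0 := by
          intro h0
          have := hlow t ht z hz
          rw [h0, norm_zero] at this
          linarith
        have h1 : HasDerivAt (fun z : ℂ => (t:ℂ) - z) (-1) z := by
          simpa using (hasDerivAt_id z).const_sub (t:ℂ)
        have h2 := h1.inv hne
        rw [neg_neg, one_div] at h2
        exact h2)
    exact h.2.differentiableAt.differentiableWithinAt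
  exact key.congr hfz

lemma neg_mem_offRplus {x : ℝ} (hx : 0 < x) : (-(x:ℂ)) ∈ offRplus := by
  simp [offRplus, hx]

lemma IsStieltjesPM.bound {f : ℂ → ℂ} (hf : IsStieltjesPM f) {x : ℝ} (hx : 0 < x) :
    f (-(x:ℂ)) ≠ 0 ∧ ‖f (-(x:ℂ))‖ ≤ x⁻¹ := by
  obtain ⟨μ, hμ, hμ0, hfz⟩ := hf
  have hae : ∀ᵐ t ∂μ, (0:ℝ) ≤ t := by
    rw [ae_iff]
    convert hμ0 using 2
    ext t; simp
  have h1 : f (-(x:ℂ)) = ((∫ t, (t + x)⁻¹ ∂μ : ℝ) : ℂ) := by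
    rw [hfz _ (neg_mem_offRplus hx), ← integral_complex_ofReal]
    congr 1
    ext t
    push_cast
    simp
  have hb : ∀ᵐ t ∂μ, ‖(t + x)⁻¹‖ ≤ x⁻¹ := by
    filter_upwards [hae] with t ht
    rw [Real.norm_of_nonneg (by positivity)]
    exact inv_anti₀ hx (by linarith)
  have hfi : Integrable (fun t : ℝ => (t + x)⁻¹) μ :=
    Integrable.of_bound
      (by fun_prop : Measurable (fun t : ℝ => (t + x)⁻¹)).aestronglyMeasurable _ hb
  have hpos : 0 < ∫ t, (t + x)⁻¹ ∂μ := by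
    have hnn : 0 ≤ᵐ[μ] fun t : ℝ => (t + x)⁻¹ := by
      filter_upwards [hae] with t ht
      simp only [Pi.zero_apply]
      positivity
    refine lt_of_le_of_ne (integral_nonneg_of_ae hnn) fun h0 => ?_
    have h2 := (integral_eq_zero_iff_of_nonneg_ae hnn hfi).1 h0.symm
    have h3 : ∀ᵐ t ∂μ, False := by
      filter_upwards [hae, h2] with t ht h4
      have : 0 < (t + x)⁻¹ := by positivity
      simp only [Pi.zero_apply] at h4
      linarith
    simp at h3
    exact IsProbabilityMeasure.ne_zero μ h3
  refine ⟨?_, ?_⟩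
  · rw [h1]
    exact_mod_cast hpos.ne'
  · rw [h1, Complex.norm_real]
    have := norm_integral_le_of_norm_le_const hb
    simpa using this

attribute [local instance] Matrix.linftyOpNormedAddCommGroup Matrix.linftyOpNormedSpace
  Matrix.linftyOpNormedRing Matrix.linftyOpNormedAlgebra

lemma norm_entry_le' {m k : ℕ} (M : Matrix (Fin m) (Fin k) ℂ) (i : Fin m) (j : Fin k) :
    ‖M i j‖ ≤ ‖M‖ := by
  rw [Matrix.linfty_opNorm_def]
  have h1 : ‖M i j‖₊ ≤ ∑ j, ‖M i j‖₊ :=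
    Finset.single_le_sum (f := fun j => ‖M i j‖₊) (fun _ _ => zero_le) (Finset.mem_univ j)
  have h2 := Finset.le_sup (f := fun i => ∑ j, ‖M i j‖₊) (Finset.mem_univ i)
  exact_mod_cast h1.trans h2

lemma norm_diag_le {m : ℕ} (d : Fin m → ℂ) {c : ℝ} (hc : 0 ≤ c) (h : ∀ i, ‖d i‖ ≤ c) :
    ‖Matrix.diagonal d‖ ≤ c := by
  rw [Matrix.linfty_opNorm_diagonal]
  exact (pi_norm_le_iff_of_nonneg hc).2 h

lemma norm_trace_le {m : ℕ} (s : Fin m → ℝ) (M : Matrix (Fin m) (Fin m) ℂ) :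
    ‖((Matrix.diagonal fun j => ((s j : ℂ))^2) * M).trace‖ ≤ (∑ j, (s j)^2) * ‖M‖ := by
  rw [Matrix.trace, Finset.sum_mul]
  refine (norm_sum_le _ _).trans (Finset.sum_le_sum fun j _ => ?_)
  rw [Matrix.diag_apply, Matrix.diagonal_mul, norm_mul, norm_pow, Complex.norm_real,
    Real.norm_eq_abs, sq_abs]
  exact mul_le_mul_of_nonneg_left (norm_entry_le' M j j) (sq_nonneg _)

/-- Control of the inverse of a small perturbation of an invertible diagonal matrix. -/
lemma resolvent_bound {m : ℕ} (d : Fin m → ℂ) (E : Matrix (Fin m) (Fin m) ℂ) {c : ℝ} (hc : 0 ≤ c)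
    (hd : ∀ i, d i ≠ 0) (hdc : ∀ i, ‖d i‖ ≤ c) (hE : c * ‖E‖ ≤ 1/2) :
    IsUnit ((Matrix.diagonal d)⁻¹ - E) ∧ ‖((Matrix.diagonal d)⁻¹ - E)⁻¹‖ ≤ 2 * c := by
  have hdu : IsUnit (Matrix.diagonal d).det := by
    rw [Matrix.det_diagonal, isUnit_iff_ne_zero]
    exact Finset.prod_ne_zero_iff.2 fun i _ => hd i
  have hP := norm_diag_le d hc hdc
  have hPE : ‖Matrix.diagonal d * E‖ ≤ 1/2 :=
    (norm_mul_le _ _).trans ((mul_le_mul_of_nonneg_right hP (norm_nonneg _)).trans hE)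
  have hu1 : IsUnit (1 - Matrix.diagonal d * E) :=
    isUnit_one_sub_of_norm_lt_one (by linarith)
  have hfac : Matrix.diagonal d * ((Matrix.diagonal d)⁻¹ - E) = 1 - Matrix.diagonal d * E := by
    rw [mul_sub, Matrix.mul_nonsing_inv _ hdu]
  have hu : IsUnit ((Matrix.diagonal d)⁻¹ - E) := by
    rw [← hfac, Matrix.isUnit_iff_isUnit_det, Matrix.det_mul] at hu1
    rw [Matrix.isUnit_iff_isUnit_det]
    exact isUnit_of_mul_isUnit_right hu1
  refine ⟨hu, ?_⟩
  have hud := (Matrix.isUnit_iff_isUnit_det _).1 hu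
  set T := ((Matrix.diagonal d)⁻¹ - E)⁻¹ with hT
  have h1 : ((Matrix.diagonal d)⁻¹ - E) * T = 1 := Matrix.mul_nonsing_inv _ hud
  have h2 : T = Matrix.diagonal d + Matrix.diagonal d * E * T := by
    have : Matrix.diagonal d * (((Matrix.diagonal d)⁻¹ - E) * T) = Matrix.diagonal d := by
      rw [h1, mul_one]
    rw [← mul_assoc, hfac, sub_mul, one_mul] at this
    exact sub_eq_iff_eq_add.1 this
  have h3 : ‖T‖ ≤ c + 1/2 * ‖T‖ := by
    calc ‖T‖ = ‖Matrix.diagonal d + Matrix.diagonal d * E * T‖ := by rw [← h2]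
      _ ≤ ‖Matrix.diagonal d‖ + ‖Matrix.diagonal d * E * T‖ := norm_add_le _ _
      _ ≤ c + 1/2 * ‖T‖ := add_le_add hP ((norm_mul_le _ _).trans
          (mul_le_mul_of_nonneg_right hPE (norm_nonneg _)))
  linarith

lemma norm_triple {m k : ℕ} (B : Matrix (Fin m) (Fin k) ℂ) (D : Matrix (Fin k) (Fin k) ℂ)
    (z : ℂ) : ‖z • (B * D * Bᵀ)‖ ≤ ‖z‖ * (‖B‖ * ‖D‖ * ‖Bᵀ‖) := by
  rw [norm_smul]
  gcongr
  refine (Matrix.linfty_opNorm_mul _ _).trans ?_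
  gcongr
  exact Matrix.linfty_opNorm_mul _ _

/-- One half of the contraction estimate. -/
lemma half_step {m k : ℕ} (B : Matrix (Fin m) (Fin k) ℂ) (p q : Fin m → ℂ) (pt qt : Fin k → ℂ)
    {x u v : ℝ} (hx : 0 < x) (hp : ∀ i, p i ≠ 0 ∧ ‖p i‖ ≤ x⁻¹) (hq : ∀ i, q i ≠ 0 ∧ ‖q i‖ ≤ x⁻¹)
    (hpt : ∀ i, pt i ≠ 0 ∧ ‖pt i‖ ≤ x⁻¹) (hqt : ∀ i, qt i ≠ 0 ∧ ‖qt i‖ ≤ x⁻¹)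
    (hxB : 2 * (‖B‖ * ‖Bᵀ‖) ≤ x) (hu : 0 ≤ u) (hv : 0 ≤ v)
    (hpq : ∀ i, ‖(p i)⁻¹ - (q i)⁻¹‖ ≤ x * u) (hpqt : ∀ j, ‖(pt j)⁻¹ - (qt j)⁻¹‖ ≤ x * v) :
    ‖((Matrix.diagonal p)⁻¹ - (-(x:ℂ)) • (B * Matrix.diagonal pt * Bᵀ))⁻¹
      - ((Matrix.diagonal q)⁻¹ - (-(x:ℂ)) • (B * Matrix.diagonal qt * Bᵀ))⁻¹‖
      ≤ 4 * x⁻¹ * u + 2 * x⁻¹ * v := by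
  have hnx : ‖-(x:ℂ)‖ = x := by simp [abs_of_pos hx]
  have hEb : ∀ r : Fin k → ℂ, (∀ i, r i ≠ 0 ∧ ‖r i‖ ≤ x⁻¹) →
      x⁻¹ * ‖(-(x:ℂ)) • (B * Matrix.diagonal r * Bᵀ)‖ ≤ 1/2 := by
    intro r hr
    have h1 := norm_triple B (Matrix.diagonal r) (-(x:ℂ))
    have h2 := norm_diag_le r (by positivity) (fun i => (hr i).2)
    rw [hnx] at h1
    calc x⁻¹ * ‖(-(x:ℂ)) • (B * Matrix.diagonal r * Bᵀ)‖
        ≤ x⁻¹ * (x * (‖B‖ * x⁻¹ * ‖Bᵀ‖)) := by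
          refine mul_le_mul_of_nonneg_left (h1.trans ?_) (by positivity)
          gcongr
      _ = x⁻¹ * (‖B‖ * ‖Bᵀ‖) := by field_simp
      _ ≤ x⁻¹ * (x / 2) := by
          refine mul_le_mul_of_nonneg_left ?_ (by positivity)
          linarith
      _ = 1/2 := by field_simp
  obtain ⟨up, bp⟩ := resolvent_bound p _ (by positivity) (fun i => (hp i).1) (fun i => (hp i).2)
    (hEb pt hpt)
  obtain ⟨uq, bq⟩ := resolvent_bound q _ (by positivity) (fun i => (hq i).1) (fun i => (hq i).2)
    (hEb qt hqt)
  set R := (Matrix.diagonal p)⁻¹ - (-(x:ℂ)) • (B * Matrix.diagonal pt * Bᵀ) with hR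
  set S := (Matrix.diagonal q)⁻¹ - (-(x:ℂ)) • (B * Matrix.diagonal qt * Bᵀ) with hS
  have hres : R⁻¹ - S⁻¹ = R⁻¹ * (S - R) * S⁻¹ := by
    rw [mul_sub, sub_mul, mul_assoc, Matrix.mul_nonsing_inv S ((Matrix.isUnit_iff_isUnit_det _).1 uq),
      Matrix.nonsing_inv_mul R ((Matrix.isUnit_iff_isUnit_det _).1 up), mul_one, one_mul]
  have hinv : ∀ r : Fin m → ℂ, (∀ i, r i ≠ 0 ∧ ‖r i‖ ≤ x⁻¹) →
      (Matrix.diagonal r)⁻¹ = Matrix.diagonal (fun i => (r i)⁻¹) := by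
    intro r hr
    apply Matrix.inv_eq_right_inv
    rw [Matrix.diagonal_mul_diagonal, ← Matrix.diagonal_one]
    congr 1
    ext i
    exact mul_inv_cancel₀ (hr i).1
  have hSR : S - R = Matrix.diagonal (fun i => (q i)⁻¹ - (p i)⁻¹)
      + (-(x:ℂ)) • (B * Matrix.diagonal (fun j => pt j - qt j) * Bᵀ) := by
    rw [hR, hS, hinv p hp, hinv q hq, ← Matrix.diagonal_sub, ← Matrix.diagonal_sub,
      Matrix.mul_sub, Matrix.sub_mul, smul_sub]
    abel
  have hdt : ∀ j, ‖pt j - qt j‖ ≤ x⁻¹ * v := by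
    intro j
    have h1 : pt j - qt j = - (pt j * qt j * ((pt j)⁻¹ - (qt j)⁻¹)) := by
      have := (hpt j).1
      have := (hqt j).1
      field_simp
      ring
    rw [h1, norm_neg, norm_mul, norm_mul]
    calc _ ≤ x⁻¹ * x⁻¹ * (x * v) := by
          gcongr
          exacts [(hpt j).2, (hqt j).2, hpqt j]
      _ = x⁻¹ * v := by field_simp
  have hSRn : ‖S - R‖ ≤ x * u + x / 2 * v := by
    rw [hSR]
    refine (norm_add_le _ _).trans (add_le_add ?_ ?_)
    · exact norm_diag_le _ (by positivity) (fun i => by rw [norm_sub_rev]; exact hpq i)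
    · have h1 := norm_triple B (Matrix.diagonal (fun j => pt j - qt j)) (-(x:ℂ))
      have h2 := norm_diag_le _ (by positivity) hdt
      rw [hnx] at h1
      refine h1.trans ?_
      calc x * (‖B‖ * ‖Matrix.diagonal (fun j => pt j - qt j)‖ * ‖Bᵀ‖)
          ≤ x * (‖B‖ * (x⁻¹ * v) * ‖Bᵀ‖) := by gcongr
        _ = (‖B‖ * ‖Bᵀ‖) * v := by field_simp
        _ ≤ x / 2 * v := by
          refine mul_le_mul_of_nonneg_right ?_ hv
          linarith
  rw [hres]
  calc ‖R⁻¹ * (S - R) * S⁻¹‖ ≤ ‖R⁻¹‖ * ‖S - R‖ * ‖S⁻¹‖ :=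
        (norm_mul_le _ _).trans (mul_le_mul_of_nonneg_right (norm_mul_le _ _) (norm_nonneg _))
    _ ≤ (2 * x⁻¹) * (x * u + x / 2 * v) * (2 * x⁻¹) := by gcongr
    _ = 4 * x⁻¹ * u + 2 * x⁻¹ * v := by field_simp; ring

lemma inv_diff_bound {m : ℕ} (n : ℕ) (s : Fin m → ℝ) (M M' : Matrix (Fin m) (Fin m) ℂ)
    (a b : ℂ) {x K : ℝ} (hx : 0 < x) (hK : ‖(n:ℂ)⁻¹‖ * (∑ j, (s j)^2) ≤ K)
    (ha : a = -(-(x:ℂ) * (1 + (n : ℂ)⁻¹ * ((Matrix.diagonal fun j => ((s j : ℂ))^2) * M).trace))⁻¹)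
    (hb : b = -(-(x:ℂ) * (1 + (n : ℂ)⁻¹ * ((Matrix.diagonal fun j => ((s j : ℂ))^2) * M').trace))⁻¹) :
    ‖a⁻¹ - b⁻¹‖ ≤ x * (K * ‖M - M'‖) := by
  have h : a⁻¹ - b⁻¹ = (x:ℂ) * ((n:ℂ)⁻¹ *
      ((Matrix.diagonal fun j => ((s j : ℂ))^2) * (M - M')).trace) := by
    rw [ha, hb, mul_sub, Matrix.trace_sub, inv_neg, inv_inv, inv_neg, inv_inv]
    ring
  rw [h, norm_mul, norm_mul, Complex.norm_real, Real.norm_of_nonneg hx.le]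
  refine mul_le_mul_of_nonneg_left ?_ hx.le
  calc _ ≤ ‖(n:ℂ)⁻¹‖ * ((∑ j, (s j)^2) * ‖M - M'‖) := by
        gcongr
        exact norm_trace_le _ _
    _ = (‖(n:ℂ)⁻¹‖ * (∑ j, (s j)^2)) * ‖M - M'‖ := by ring
    _ ≤ _ := by gcongr

lemma eq_far (N n : ℕ) (σ : Fin N → Fin n → ℝ) (A : Matrix (Fin N) (Fin n) ℝ)
    (ψ φ : Fin N → ℂ → ℂ) (ψt φt : Fin n → ℂ → ℂ)
    (hψ : SolvesSystem σ A ψ ψt) (hφ : SolvesSystem σ A φ φt) :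
    ∃ X : ℝ, 0 < X ∧ ∀ x : ℝ, X < x →
      (∀ i, ψ i (-(x:ℂ)) = φ i (-(x:ℂ))) ∧ (∀ j, ψt j (-(x:ℂ)) = φt j (-(x:ℂ))) := by
  obtain ⟨hψ1, hψ2, hψ3⟩ := hψ
  obtain ⟨hφ1, hφ2, hφ3⟩ := hφ
  set B : Matrix (Fin N) (Fin n) ℂ := A.map Complex.ofReal with hB
  set K : ℝ := ‖(n:ℂ)⁻¹‖ * ∑ i, ∑ j, (σ i j)^2 with hKdef
  have hK0 : 0 ≤ K := by positivity
  have hK1 : ∀ i, ‖(n:ℂ)⁻¹‖ * (∑ j, (σ i j)^2) ≤ K := fun i => by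
    refine mul_le_mul_of_nonneg_left ?_ (norm_nonneg _)
    exact Finset.single_le_sum (f := fun i => ∑ j, (σ i j)^2) (fun _ _ => by positivity)
      (Finset.mem_univ i)
  have hK2 : ∀ j, ‖(n:ℂ)⁻¹‖ * (∑ i, (σ i j)^2) ≤ K := fun j => by
    rw [hKdef, Finset.sum_comm]
    refine mul_le_mul_of_nonneg_left ?_ (norm_nonneg _)
    exact Finset.single_le_sum (f := fun j => ∑ i, (σ i j)^2) (fun _ _ => by positivity)
      (Finset.mem_univ j)
  refine ⟨1 + 2 * (‖B‖ * ‖Bᵀ‖) + 6 * K, by positivity, fun x hxX => ?_⟩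
  have hBB : 0 ≤ ‖B‖ * ‖Bᵀ‖ := by positivity
  have hx : 0 < x := by linarith
  have hmem := neg_mem_offRplus hx
  set z : ℂ := -(x:ℂ) with hz
  set d := ‖Tmat A ψ ψt z - Tmat A φ φt z‖ with hd
  set dt := ‖Ttmat A ψ ψt z - Ttmat A φ φt z‖ with hdt
  have e1 : ∀ i, ‖(ψ i z)⁻¹ - (φ i z)⁻¹‖ ≤ x * (K * dt) := fun i =>
    inv_diff_bound n (σ i) _ _ _ _ hx (hK1 i) ((hψ3 z hmem).1 i) ((hφ3 z hmem).1 i)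
  have e2 : ∀ j, ‖(ψt j z)⁻¹ - (φt j z)⁻¹‖ ≤ x * (K * d) := fun j =>
    inv_diff_bound n (fun i => σ i j) _ _ _ _ hx (hK2 j) ((hψ3 z hmem).2 j) ((hφ3 z hmem).2 j)
  have hd0 : 0 ≤ d := norm_nonneg _
  have hdt0 : 0 ≤ dt := norm_nonneg _
  have s1 : d ≤ 4 * x⁻¹ * (K * dt) + 2 * x⁻¹ * (K * d) :=
    half_step B _ _ _ _ hx (fun i => (hψ1 i).bound hx) (fun i => (hφ1 i).bound hx)
      (fun i => (hψ2 i).bound hx) (fun i => (hφ2 i).bound hx) (by linarith)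
      (by positivity) (by positivity) e1 e2
  have s2 : dt ≤ 4 * x⁻¹ * (K * d) + 2 * x⁻¹ * (K * dt) :=
    half_step Bᵀ _ _ _ _ hx (fun i => (hψ2 i).bound hx) (fun i => (hφ2 i).bound hx)
      (fun i => (hψ1 i).bound hx) (fun i => (hφ1 i).bound hx)
      (by rw [Matrix.transpose_transpose]; linarith)
      (by positivity) (by positivity) e2 e1
  have hs : x * (d + dt) ≤ 6 * K * (d + dt) := by
    calc x * (d + dt) ≤ x * ((4 * x⁻¹ * (K * dt) + 2 * x⁻¹ * (K * d))
          + (4 * x⁻¹ * (K * d) + 2 * x⁻¹ * (K * dt))) := by gcongr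
      _ = 6 * K * (d + dt) := by field_simp; ring
  have hzero : d + dt = 0 := by
    by_contra hne
    have hpos : 0 < d + dt := lt_of_le_of_ne (by positivity) (Ne.symm hne)
    have := le_of_mul_le_mul_right hs hpos
    linarith
  have hd' : d = 0 := by linarith
  have hdt' : dt = 0 := by linarith
  constructor
  · intro i
    have := e1 i
    rw [hdt', mul_zero, mul_zero] at this
    exact inv_injective (sub_eq_zero.1 (norm_le_zero_iff.1 this))
  · intro j
    have := e2 j
    rw [hd', mul_zero, mul_zero] at this
    exact inv_injective (sub_eq_zero.1 (norm_le_zero_iff.1 this))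

lemma stieltjes_ext {f g : ℂ → ℂ} (hf : IsStieltjesPM f) (hg : IsStieltjesPM g) {X : ℝ}
    (hX : 0 < X) (h : ∀ x : ℝ, X < x → f (-(x:ℂ)) = g (-(x:ℂ))) :
    ∀ z ∈ offRplus, f z = g z := by
  have hfa := hf.differentiableOn.analyticOnNhd isOpen_offRplus
  have hga := hg.differentiableOn.analyticOnNhd isOpen_offRplus
  have hfreq : ∃ᶠ z in 𝓝[≠] (-(X:ℂ)), f z = g z := by
    have ht : Tendsto (fun x : ℝ => -(x:ℂ)) (𝓝[>] X) (𝓝[≠] (-(X:ℂ))) := by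
      refine tendsto_nhdsWithin_iff.2 ⟨?_, ?_⟩
      · exact ((by fun_prop : Continuous (fun x : ℝ => -(x:ℂ))).tendsto X).mono_left
          nhdsWithin_le_nhds
      · filter_upwards [self_mem_nhdsWithin] with x hx
        simp only [Set.mem_compl_iff, Set.mem_singleton_iff, neg_inj, Complex.ofReal_inj]
        exact ne_of_gt hx
    refine ht.frequently (Eventually.frequently ?_)
    filter_upwards [self_mem_nhdsWithin] with x hx using h x hx
  exact hfa.eqOn_of_preconnected_of_frequently_eq hga isPreconnected_offRplus
    (neg_mem_offRplus hX) hfreq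

/-- Proposition 5.2 (uniqueness of solutions of the system of `N + n` equations). -/
theorem stmt_9 (N n : ℕ) (hN : 0 < N) (hn : 0 < n)
    (σ : Fin N → Fin n → ℝ) (A : Matrix (Fin N) (Fin n) ℝ)
    (ψ φ : Fin N → ℂ → ℂ) (ψt φt : Fin n → ℂ → ℂ)
    (hψ : SolvesSystem σ A ψ ψt) (hφ : SolvesSystem σ A φ φt) :
    ∀ z ∈ offRplus, (∀ i, ψ i z = φ i z) ∧ (∀ j, ψt j z = φt j z) := by
  obtain ⟨X, hX, h⟩ := eq_far N n σ A ψ φ ψt φt hψ hφ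
  intro z hz
  exact ⟨fun i => stieltjes_ext (hψ.1 i) (hφ.1 i) hX (fun x hx => (h x hx).1 i) z hz,
    fun j => stieltjes_ext (hψ.2.1 j) (hφ.2.1 j) hX (fun x hx => (h x hx).2 j) z hz⟩
end
end

section
/- There exists a family (ψ_i, ψ̃_j; 1 ≤ i ≤ N, 1 ≤ j ≤ n) ∈ S(ℝ+)^{N+n} satisfying the system of N+n equations. -/
open MeasureTheory Matrix Complex Filter
open scoped Topology ComplexOrder

noncomputable section

section Spectral
variable {E : Type*} [NormedAddCommGroup E] [InnerProductSpace ℂ E] [CompleteSpace E]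

lemma spectral_aux (T : E →L[ℂ] E) (hT : IsSelfAdjoint T) (e : E) (he : ‖e‖ = 1) :
    ∃ ν : Measure (spectrum ℝ T), IsProbabilityMeasure ν ∧
      ∀ f : C(spectrum ℝ T, ℝ), inner ℂ e (cfcHom hT f e) = ((∫ t, f t ∂ν : ℝ) : ℂ) := by
  have hsa : ∀ f : C(spectrum ℝ T, ℝ), ∀ x y : E,
      inner ℂ (cfcHom hT f x) y = inner ℂ x (cfcHom hT f y) := by
    intro f x y
    have h1 : IsSelfAdjoint (cfcHom hT f) := by
      rw [IsSelfAdjoint, ← map_star]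
      congr 1
    exact (ContinuousLinearMap.isSelfAdjoint_iff_isSymmetric.mp h1) x y
  have hre : ∀ f : C(spectrum ℝ T, ℝ),
      inner ℂ e (cfcHom hT f e) = ((inner ℂ e (cfcHom hT f e)).re : ℂ) := by
    intro f
    have := hsa f e e
    rw [← inner_conj_symm] at this
    exact (Complex.conj_eq_iff_re.mp this).symm
  have hpos : ∀ f : C(spectrum ℝ T, ℝ), (∀ t, 0 ≤ f t) → 0 ≤ (inner ℂ e (cfcHom hT f e)).re := by
    intro f hf
    let g : C(spectrum ℝ T, ℝ) := ⟨fun t => Real.sqrt (f t), by fun_prop⟩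
    have hg : f = g * g := by
      ext t
      simp [g, Real.mul_self_sqrt (hf t)]
    rw [hg, map_mul, mul_apply_eq_comp, ← hsa]
    exact inner_self_nonneg (𝕜 := ℂ)
  let Λ : CompactlySupportedContinuousMap (spectrum ℝ T) ℝ →ₚ[ℝ] ℝ := PositiveLinearMap.mk₀
    { toFun := fun f => (inner ℂ e (cfcHom hT (f : C(spectrum ℝ T, ℝ)) e)).re
      map_add' := by
        intro f g
        have : ((f + g : CompactlySupportedContinuousMap (spectrum ℝ T) ℝ) : C(spectrum ℝ T, ℝ))
          = (f : C(spectrum ℝ T, ℝ)) + (g : C(spectrum ℝ T, ℝ)) := by ext; rfl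
        rw [this, map_add]
        simp
      map_smul' := by
        intro c f
        have : ((c • f : CompactlySupportedContinuousMap (spectrum ℝ T) ℝ) : C(spectrum ℝ T, ℝ))
          = c • (f : C(spectrum ℝ T, ℝ)) := by ext; rfl
        rw [this, map_smul]
        have h2 : ((c • cfcHom hT (f : C(spectrum ℝ T, ℝ))) e)
          = (c : ℂ) • (cfcHom hT (f : C(spectrum ℝ T, ℝ)) e) := by simp
        rw [h2, inner_smul_right]
        simp } (by
      intro f hf
      exact hpos _ (fun t => hf t))
  have key : ∀ f : C(spectrum ℝ T, ℝ), ∫ t, f t ∂(RealRMK.rieszMeasure Λ)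
      = (inner ℂ e (cfcHom hT f e)).re := by
    intro f
    exact RealRMK.integral_rieszMeasure Λ (CompactlySupportedContinuousMap.continuousMapEquiv f)
  have h1 := key 1
  rw [map_one] at h1
  simp [he] at h1
  refine ⟨RealRMK.rieszMeasure Λ, ⟨?_⟩, fun f => ?_⟩
  · rw [Measure.real] at h1
    rw [← ENNReal.toReal_eq_one_iff]; exact h1
  · rw [key, hre]; simp

lemma spectral (T : E →L[ℂ] E) (hT : IsSelfAdjoint T) (e : E) (he : ‖e‖ = 1) :
    ∃ μ : Measure ℝ, IsProbabilityMeasure μ ∧ μ (Set.Iio 0) = 0 ∧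
      ∀ z ∈ offRplus, ∀ y : E, T (T y) - z • y = e →
        inner ℂ e y = ∫ t, ((t : ℂ) - z)⁻¹ ∂μ := by
  obtain ⟨ν, hν, hfun⟩ := spectral_aux T hT e he
  have hm : Measurable (fun t : spectrum ℝ T => (t : ℝ) ^ 2) := by fun_prop
  refine ⟨ν.map (fun t : spectrum ℝ T => (t : ℝ) ^ 2), Measure.isProbabilityMeasure_map hm.aemeasurable, ?_, ?_⟩
  · rw [Measure.map_apply hm measurableSet_Iio]
    convert measure_empty (μ := ν)
    ext t
    simp [sq_nonneg]
  intro z hz y hy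
  have hne : ∀ t : ℝ, ((t : ℂ) ^ 2 - z) ≠ 0 := by
    intro t h
    apply hz
    have : z = ((t ^ 2 : ℝ) : ℂ) := by push_cast; linear_combination -h
    rw [this]
    exact ⟨Complex.ofReal_im _, by rw [Complex.ofReal_re]; positivity⟩
  let F : spectrum ℝ T → ℂ := fun t => (((t : ℝ) : ℂ) ^ 2 - z)⁻¹
  have hF : Continuous F := by
    apply Continuous.inv₀ (by fun_prop)
    intro t; exact hne t
  let u : C(spectrum ℝ T, ℝ) := ⟨fun t => (F t).re, by fun_prop⟩
  let v : C(spectrum ℝ T, ℝ) := ⟨fun t => (F t).im, by fun_prop⟩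
  have hmi : ∀ c : ℝ, cfcHom hT (ContinuousMap.const _ c : C(spectrum ℝ T, ℝ)) = (c : ℂ) • 1 := by
    intro c
    have : (ContinuousMap.const _ c : C(spectrum ℝ T, ℝ)) = c • 1 := by ext; simp
    rw [this, map_smul, map_one]
    ext x; simp
  let X : C(spectrum ℝ T, ℝ) := (ContinuousMap.id ℝ).restrict (spectrum ℝ T)
  have hX : cfcHom hT X = T := cfcHom_id hT
  have e0 : ∀ t : spectrum ℝ T, F t * (((t : ℝ) : ℂ) ^ 2 - z) = 1 := fun t =>
    inv_mul_cancel₀ (hne t)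
  have e1 : u * (X * X) - u * ContinuousMap.const _ z.re + v * ContinuousMap.const _ z.im = 1 := by
    ext t
    have := congrArg Complex.re (e0 t)
    simp [pow_two] at this
    simp [u, v, X]
    linarith
  have e2 : v * (X * X) - v * ContinuousMap.const _ z.re - u * ContinuousMap.const _ z.im = 0 := by
    ext t
    have := congrArg Complex.im (e0 t)
    simp [pow_two] at this
    simp [u, v, X]
    linarith
  have E1 := congrArg (fun S => S y) (congrArg (cfcHom hT) e1)
  have E2 := congrArg (fun S => S y) (congrArg (cfcHom hT) e2)
  simp only [map_add, map_sub, map_mul, hX, hmi, map_one, map_zero] at E1 E2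
  simp at E1 E2
  have hy2 : y = cfcHom hT u e + Complex.I • cfcHom hT v e := by
    rw [← hy]
    simp only [map_sub, map_smul]
    have hzz : z = (z.re : ℂ) + z.im * Complex.I := (Complex.re_add_im z).symm
    set a := cfcHom hT u y
    set b := cfcHom hT v y
    set a2 := cfcHom hT u (T (T y))
    set b2 := cfcHom hT v (T (T y))
    have : a2 - z • a + Complex.I • (b2 - z • b)
       = (a2 - (z.re : ℂ) • a + (z.im : ℂ) • b) + Complex.I • (b2 - (z.re : ℂ) • b - (z.im : ℂ) • a) := by
      conv_lhs => rw [hzz]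
      have hI : Complex.I • ((z.im : ℂ) • Complex.I • b) = -((z.im : ℂ) • b) := by
        rw [smul_smul, smul_smul, ← neg_smul]; congr 1; linear_combination (z.im : ℂ) * Complex.I_mul_I
      simp only [smul_sub, add_smul, smul_add, mul_smul]
      rw [hI]
      rw [smul_comm Complex.I (z.im : ℂ) a]
      abel
    rw [this]
    simp only [Complex.coe_smul] at *
    rw [E1, E2]; simp
  rw [integral_map hm.aemeasurable (by
    apply Measurable.aestronglyMeasurable
    fun_prop)]
  have : ∀ t : spectrum ℝ T, ((((t : ℝ) ^ 2 : ℝ) : ℂ) - z)⁻¹ = F t := by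
    intro t; simp [F]
  simp_rw [this]
  have hFi : Integrable F ν := by
    have : Integrable (⟨F, hF⟩ : C(spectrum ℝ T, ℂ)) ν := 
      (ContinuousMap.continuous _).integrable_of_hasCompactSupport (HasCompactSupport.of_compactSpace _)
    exact this
  rw [← integral_re_add_im hFi]
  conv_lhs => rw [hy2]
  rw [inner_add_right, inner_smul_right, hfun, hfun]
  simp [u, v, mul_comm]

end Spectral

set_option linter.unusedSectionVars false

section Tree
variable {M : Type*} [Fintype M] [DecidableEq M]

/-- Vertices of the infinite tree of copies of `M`. -/
abbrev Vtx (M : Type*) := List (M × M) × M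

/-- The Hilbert space of square summable families. -/
abbrev Hil (V : Type*) := lp (fun _ : V => ℂ) 2

/-- Basis vectors. -/
def dl {V : Type*} [DecidableEq V] (v : V) : Hil V := lp.single 2 v (1 : ℂ)

lemma inner_dl_left {V : Type*} [DecidableEq V] (v : V) (x : Hil V) :
    inner ℂ (dl v) x = x v := by
  simp [dl, lp.inner_single_left]

lemma inner_dl {V : Type*} [DecidableEq V] (v v' : V) :
    inner ℂ (dl v) (dl v') = if v = v' then (1 : ℂ) else 0 := by
  rw [inner_dl_left]
  simp [dl, Pi.single_apply]

lemma hil_ext {V : Type*} [DecidableEq V] {x y : Hil V}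
    (h : ∀ v, inner ℂ (dl v) x = inner ℂ (dl v) y) : x = y := by
  ext v
  simpa [inner_dl_left] using h v

lemma norm_dl {V : Type*} [DecidableEq V] (v : V) : ‖dl v‖ = 1 := by
  rw [dl, lp.norm_single (by norm_num)]
  simp

lemma exists_push {W V : Type*} [DecidableEq W] [DecidableEq V] (f : W → V)
    (hf : Function.Injective f) :
    ∃ J : Hil W →L[ℂ] Hil V, (∀ w, J (dl w) = dl (f w)) := by
  have ho : Orthonormal ℂ (fun w => dl (f w)) := by
    rw [orthonormal_iff_ite]
    intro i j
    rw [inner_dl]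
    simp [hf.eq_iff]
  refine ⟨ho.orthogonalFamily.linearIsometry.toContinuousLinearMap, fun w => ?_⟩
  show ho.orthogonalFamily.linearIsometry (dl w) = _
  rw [dl, OrthogonalFamily.linearIsometry_apply_single]
  simp

/-- Isometry induced by an injection. -/
def push {W V : Type*} [DecidableEq W] [DecidableEq V] (f : W → V)
    (hf : Function.Injective f) : Hil W →L[ℂ] Hil V := (exists_push f hf).choose

lemma push_dl {W V : Type*} [DecidableEq W] [DecidableEq V] (f : W → V)
    (hf : Function.Injective f) (w : W) : push f hf (dl w) = dl (f w) :=
  (exists_push f hf).choose_spec w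

lemma push_adj {W V : Type*} [DecidableEq W] [DecidableEq V] (f : W → V)
    (hf : Function.Injective f) (w : W) :
    ContinuousLinearMap.adjoint (push f hf) (dl (f w)) = dl w := by
  apply hil_ext
  intro v
  rw [ContinuousLinearMap.adjoint_inner_right, push_dl, inner_dl, inner_dl]
  simp [hf.eq_iff]

lemma push_adj_zero {W V : Type*} [DecidableEq W] [DecidableEq V] (f : W → V)
    (hf : Function.Injective f) (v : V) (hv : ∀ w, f w ≠ v) :
    ContinuousLinearMap.adjoint (push f hf) (dl v) = 0 := by
  apply hil_ext
  intro w
  rw [ContinuousLinearMap.adjoint_inner_right, push_dl, inner_dl]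
  simp [hv]

/-- Site isometries. -/
def Qop (k : M) : Hil (List (M × M)) →L[ℂ] Hil (Vtx M) :=
  push (fun p => (p, k)) (fun a b h => by simpa using h)

/-- Child isometries. -/
def Uop (c : M × M) : Hil (List (M × M)) →L[ℂ] Hil (Vtx M) :=
  push (fun p => (p ++ [c], c.2)) (fun a b h => by simpa using h)

/-- Subtree isometries. -/
def Sop (c : M × M) : Hil (Vtx M) →L[ℂ] Hil (Vtx M) :=
  push (fun v => (c :: v.1, v.2)) (fun a b h => by
    obtain ⟨a1, a2⟩ := a
    obtain ⟨b1, b2⟩ := b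
    simpa using h)

lemma Qop_dl (k : M) (p : List (M × M)) : Qop k (dl p) = dl (p, k) := push_dl _ _ _
lemma Uop_dl (c : M × M) (p : List (M × M)) : Uop c (dl p) = dl (p ++ [c], c.2) := push_dl _ _ _
lemma Sop_dl (c : M × M) (p : List (M × M)) (k : M) : Sop c (dl (p, k)) = dl (c :: p, k) :=
  push_dl _ _ _

lemma Qop_adj (k k' : M) (p : List (M × M)) :
    ContinuousLinearMap.adjoint (Qop k) (dl (p, k')) = if k = k' then dl p else 0 := by
  split_ifs with h
  · subst h; exact push_adj (fun p : List (M × M) => (p, k)) _ p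
  · exact push_adj_zero _ _ _ (by simp [h])

lemma Uop_adj_nil (c : M × M) (k : M) :
    ContinuousLinearMap.adjoint (Uop c) (dl ([], k)) = 0 :=
  push_adj_zero _ _ _ (by simp)

lemma Uop_adj (c d : M × M) (k : M) (p : List (M × M)) :
    ContinuousLinearMap.adjoint (Uop c) (dl (p ++ [d], k))
      = if c = d then (if k = d.2 then dl p else 0) else 0 := by
  split_ifs with h h'
  · subst h; subst h'; exact push_adj (fun p : List (M × M) => (p ++ [c], c.2)) _ p
  · exact push_adj_zero _ _ _ (by
      intro w hw
      simp at hw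
      rw [← hw.2, h] at h'
      exact h' rfl)
  · exact push_adj_zero _ _ _ (by
      intro w hw
      simp at hw
      exact h hw.1.2)

/-- The upper half of the operator. -/
def Kop (r : M × M → ℝ) : Hil (Vtx M) →L[ℂ] Hil (Vtx M) :=
  ∑ c : M × M, (r c : ℂ) • ((Uop c).comp (ContinuousLinearMap.adjoint (Qop c.1)))



/-- The intra-copy part. -/
def Bop (H : M → M → ℝ) : Hil (Vtx M) →L[ℂ] Hil (Vtx M) :=
  ∑ a : M, ∑ b : M, (H a b : ℂ) • ((Qop a).comp (ContinuousLinearMap.adjoint (Qop b)))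

/-- Root vectors. -/
def rt (k : M) : Hil (Vtx M) := dl ([], k)

/-- The intra-copy part at the root. -/
def Rop (H : M → M → ℝ) : Hil (Vtx M) →L[ℂ] Hil (Vtx M) :=
  ∑ a : M, ∑ b : M, (H a b : ℂ) • ((innerSL ℂ (rt b)).smulRight (rt a))

lemma Kop_dl (r : M × M → ℝ) (p : List (M × M)) (k : M) :
    Kop r (dl (p, k)) = ∑ l, (r (k, l) : ℂ) • dl (p ++ [(k, l)], l) := by
  simp [-Complex.coe_smul, Kop, Qop_adj, fun c => apply_ite (Uop (M := M) c), Uop_dl, Fintype.sum_prod_type]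

lemma Kadj_eq (r : M × M → ℝ) : ContinuousLinearMap.adjoint (Kop r) =
    ∑ c : M × M, (r c : ℂ) • ((Qop c.1).comp (ContinuousLinearMap.adjoint (Uop c))) := by
  simp only [Kop, map_sum, map_smulₛₗ, ContinuousLinearMap.adjoint_comp,
    ContinuousLinearMap.adjoint_adjoint, Complex.conj_ofReal]

lemma Kadj_nil (r : M × M → ℝ) (k : M) :
    ContinuousLinearMap.adjoint (Kop r) (dl ([], k)) = 0 := by
  simp [-Complex.coe_smul, Kadj_eq, Uop_adj_nil]

lemma Kadj_dl (r : M × M → ℝ) (p : List (M × M)) (d : M × M) (k : M) :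
    ContinuousLinearMap.adjoint (Kop r) (dl (p ++ [d], k))
      = if k = d.2 then (r d : ℂ) • dl (p, d.1) else 0 := by
  simp [-Complex.coe_smul, Kadj_eq, Uop_adj, fun c => apply_ite (Qop (M := M) c), Qop_dl]

lemma Bop_dl (H : M → M → ℝ) (p : List (M × M)) (k : M) :
    Bop H (dl (p, k)) = ∑ a, (H a k : ℂ) • dl (p, a) := by
  simp [-Complex.coe_smul, Bop, Qop_adj, fun c => apply_ite (Qop (M := M) c), Qop_dl]

lemma Rop_nil (H : M → M → ℝ) (k : M) :
    Rop H (dl ([], k)) = ∑ a, (H a k : ℂ) • dl ([], a) := by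
  simp [-Complex.coe_smul, Rop, rt, inner_dl]

lemma Rop_cons (H : M → M → ℝ) (c : M × M) (p : List (M × M)) (k : M) :
    Rop H (dl (c :: p, k)) = 0 := by
  simp [-Complex.coe_smul, Rop, rt, inner_dl]

lemma Bop_sa (H : M → M → ℝ) (hH : ∀ a b, H a b = H b a) :
    ContinuousLinearMap.adjoint (Bop H) = Bop H := by
  simp only [Bop, map_sum, map_smulₛₗ, ContinuousLinearMap.adjoint_comp,
    ContinuousLinearMap.adjoint_adjoint, Complex.conj_ofReal]
  rw [Finset.sum_comm]
  refine Finset.sum_congr rfl fun a _ => Finset.sum_congr rfl fun b _ => ?_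
  rw [hH]

lemma Rop_sa (H : M → M → ℝ) (hH : ∀ a b, H a b = H b a) :
    ContinuousLinearMap.adjoint (Rop H) = Rop H := by
  symm
  rw [ContinuousLinearMap.eq_adjoint_iff]
  intro x y
  simp only [Rop, _root_.sum_apply, _root_.smul_apply,
    ContinuousLinearMap.smulRight_apply, innerSL_apply_apply, sum_inner, inner_sum, inner_smul_left,
    inner_smul_right, Complex.conj_ofReal, inner_conj_symm]
  rw [Finset.sum_comm]
  refine Finset.sum_congr rfl fun a _ => Finset.sum_congr rfl fun b _ => ?_
  rw [hH]; ring

/-- The full operator. -/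
def Lop (H : M → M → ℝ) (r : M × M → ℝ) : Hil (Vtx M) →L[ℂ] Hil (Vtx M) :=
  Bop H + (Kop r + ContinuousLinearMap.adjoint (Kop r))

/-- The operator with the root links cut. -/
def Lcut (H : M → M → ℝ) (r : M × M → ℝ) : Hil (Vtx M) →L[ℂ] Hil (Vtx M) :=
  Lop H r - Rop H

lemma Lop_sa (H : M → M → ℝ) (r : M × M → ℝ) (hH : ∀ a b, H a b = H b a) :
    ContinuousLinearMap.adjoint (Lop H r) = Lop H r := by
  simp [Lop, Bop_sa H hH, add_comm]

lemma Lcut_sa (H : M → M → ℝ) (r : M × M → ℝ) (hH : ∀ a b, H a b = H b a) :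
    ContinuousLinearMap.adjoint (Lcut H r) = Lcut H r := by
  simp [Lcut, Lop_sa H r hH, Rop_sa H hH]

lemma Lop_S (H : M → M → ℝ) (r : M × M → ℝ) (c : M × M) (v : Vtx M) :
    Lop H r (Sop c (dl v)) = Sop c (Lop H r (dl v))
      + (if v = ([], c.2) then (r c : ℂ) • rt c.1 else 0) := by
  obtain ⟨p, k⟩ := v
  rw [Sop_dl]
  simp only [Lop, _root_.add_apply, map_add, Bop_dl, Kop_dl, map_sum, map_smul,
    Sop_dl, List.cons_append]
  rcases List.eq_nil_or_concat p with rfl | ⟨q, d, rfl⟩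
  · have := Kadj_dl r [] c k
    rw [List.nil_append] at this
    rw [this, Kadj_nil]
    simp [-Complex.coe_smul, rt, add_assoc]
  · have := Kadj_dl r (c :: q) d k
    rw [List.cons_append] at this
    rw [List.concat_eq_append, this, Kadj_dl]
    split_ifs <;> simp_all [-Complex.coe_smul, Sop_dl]

lemma Lcut_S (H : M → M → ℝ) (r : M × M → ℝ) (c : M × M) (v : Vtx M) :
    Lcut H r (Sop c (dl v)) = Sop c (Lop H r (dl v))
      + (if v = ([], c.2) then (r c : ℂ) • rt c.1 else 0) := by
  obtain ⟨p, k⟩ := v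
  rw [← Lop_S, Lcut, _root_.sub_apply, Sop_dl, Rop_cons, sub_zero]

lemma S_adj_gen (H : M → M → ℝ) (r : M × M → ℝ) (hH : ∀ a b, H a b = H b a) (c : M × M)
    (L : Hil (Vtx M) →L[ℂ] Hil (Vtx M)) (hL : ContinuousLinearMap.adjoint L = L)
    (h : ∀ v, L (Sop c (dl v)) = Sop c (Lop H r (dl v))
      + (if v = ([], c.2) then (r c : ℂ) • rt c.1 else 0)) (x : Hil (Vtx M)) :
    ContinuousLinearMap.adjoint (Sop c) (L x)
      = ((r c : ℂ) * inner ℂ (rt c.1) x) • rt c.2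
        + Lop H r (ContinuousLinearMap.adjoint (Sop c) x) := by
  apply hil_ext
  intro v
  rw [ContinuousLinearMap.adjoint_inner_right, ← hL, ContinuousLinearMap.adjoint_inner_right,
    h, inner_add_left, inner_add_right, add_comm]
  congr 1
  · rw [inner_smul_right, rt, rt, inner_dl]
    split_ifs with h
    · rw [inner_smul_left]; simp
    · simp
  · rw [← ContinuousLinearMap.adjoint_inner_right, ← ContinuousLinearMap.adjoint_inner_right,
      Lop_sa H r hH]

lemma S_adj_rt (c : M × M) (k : M) : ContinuousLinearMap.adjoint (Sop c) (rt k) = 0 := 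
  push_adj_zero _ _ _ (by simp)

lemma inner_rt (k k' : M) : inner ℂ (rt k) (rt k') = if k = k' then (1 : ℂ) else 0 := by
  rw [rt, rt, inner_dl]; simp

lemma inner_Lcut (H : M → M → ℝ) (r : M × M → ℝ) (hH : ∀ a b, H a b = H b a) (k : M)
    (x : Hil (Vtx M)) : inner ℂ (rt k) (Lcut H r x)
      = ∑ l, (r (k, l) : ℂ) * inner ℂ (rt l) (ContinuousLinearMap.adjoint (Sop (k, l)) x) := by
  rw [← Lcut_sa H r hH, ContinuousLinearMap.adjoint_inner_right]
  simp only [ContinuousLinearMap.adjoint_inner_right]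
  simp only [Lcut, Lop, rt, _root_.sub_apply, _root_.add_apply,
    Bop_dl, Kop_dl, Kadj_nil, Rop_nil, Sop_dl, List.nil_append]
  simp [sum_inner]

lemma inner_Lop (H : M → M → ℝ) (r : M × M → ℝ) (hH : ∀ a b, H a b = H b a) (k : M)
    (x : Hil (Vtx M)) : inner ℂ (rt k) (Lop H r x)
      = ∑ a, (H k a : ℂ) * inner ℂ (rt a) x +
        ∑ l, (r (k, l) : ℂ) * inner ℂ (rt l) (ContinuousLinearMap.adjoint (Sop (k, l)) x) := by
  rw [← Lop_sa H r hH, ContinuousLinearMap.adjoint_inner_right]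
  simp only [ContinuousLinearMap.adjoint_inner_right]
  simp only [Lop, rt, _root_.add_apply,
    Bop_dl, Kop_dl, Kadj_nil, Sop_dl, List.nil_append]
  simp [sum_inner, inner_add_left, hH k]

/-- The grading. -/
def Gop (ε : M → ℝ) : Hil (Vtx M) →L[ℂ] Hil (Vtx M) :=
  Bop (fun a b => if a = b then ε b else 0)

lemma Gop_dl (ε : M → ℝ) (p : List (M × M)) (k : M) :
    Gop ε (dl (p, k)) = (ε k : ℂ) • dl (p, k) := by
  rw [Gop, Bop_dl]
  simp [apply_ite]

lemma Gop_sa (ε : M → ℝ) : ContinuousLinearMap.adjoint (Gop ε) = Gop ε :=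
  Bop_sa _ (by intro a b; grind)

lemma anti (ε : M → ℝ) (H : M → M → ℝ) (r : M × M → ℝ) (hH : ∀ a b, H a b = H b a)
    (h1 : ∀ a b, H a b ≠ 0 → ε a = - ε b) (h2 : ∀ a b, r (a, b) ≠ 0 → ε a = - ε b)
    (x : Hil (Vtx M)) : Gop ε (Lcut H r x) = - Lcut H r (Gop ε x) := by
  have h1' : ∀ a b, (H a b : ℂ) * ε a = - (ε b * H a b) := by
    intro a b
    by_cases h : H a b = 0
    · simp [h]
    · rw [h1 a b h]; push_cast; ring
  have h2' : ∀ a b, (r (a, b) : ℂ) * ε b = - (ε a * r (a, b)) := by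
    intro a b
    by_cases h : r (a, b) = 0
    · simp [h]
    · rw [h2 a b h]; push_cast; ring
  have hB : ∀ v : Vtx M, Gop ε (Lcut H r (dl v)) = - Lcut H r (Gop ε (dl v)) := by
    rintro ⟨p, k⟩
    have a1 : Gop ε (Bop H (dl (p, k))) = - Bop H (Gop ε (dl (p, k))) := by
      simp only [Gop_dl, Bop_dl, map_sum, map_smul, smul_smul, h1', Finset.smul_sum, neg_smul,
        Finset.sum_neg_distrib]
    have a2 : Gop ε (Kop r (dl (p, k))) = - Kop r (Gop ε (dl (p, k))) := by
      simp only [Gop_dl, Kop_dl, map_sum, map_smul, smul_smul, h2', Finset.smul_sum, neg_smul,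
        Finset.sum_neg_distrib]
    have a3 : Gop ε (ContinuousLinearMap.adjoint (Kop r) (dl (p, k)))
        = - ContinuousLinearMap.adjoint (Kop r) (Gop ε (dl (p, k))) := by
      rcases List.eq_nil_or_concat p with rfl | ⟨q, d, rfl⟩
      · simp [Gop_dl, Kadj_nil]
      · rw [List.concat_eq_append]
        simp only [Gop_dl, Kadj_dl, map_smul]
        split_ifs with h
        · subst h
          have : (r d : ℂ) * ε d.2 = - (ε d.1 * r d) := h2' d.1 d.2
          simp only [map_smul, Gop_dl, smul_smul]
          rw [← neg_smul]
          congr 1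
          linear_combination this
        · simp
    have a4 : Gop ε (Rop H (dl (p, k))) = - Rop H (Gop ε (dl (p, k))) := by
      cases p with
      | nil => 
        simp only [Gop_dl, Rop_nil, map_sum, map_smul, smul_smul, h1', Finset.smul_sum, neg_smul,
          Finset.sum_neg_distrib]
      | cons c p => simp [Gop_dl, Rop_cons]
    simp only [Lcut, Lop, _root_.sub_apply, _root_.add_apply, map_sub,
      map_add, a1, a2, a3, a4]
    abel
  apply hil_ext
  intro v
  rw [← Gop_sa, ContinuousLinearMap.adjoint_inner_right, Gop_sa, ← Lcut_sa H r hH,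
    ContinuousLinearMap.adjoint_inner_right, inner_neg_right,
    ContinuousLinearMap.adjoint_inner_right]
  conv_rhs => rw [← Gop_sa, ContinuousLinearMap.adjoint_inner_right]
  rw [hB, inner_neg_left, neg_neg]


lemma resolv {E : Type*} [NormedAddCommGroup E] [InnerProductSpace ℂ E] [CompleteSpace E]
    (T : E →L[ℂ] E) (hT : ContinuousLinearMap.adjoint T = T) (w : ℂ) (hw : w.im ≠ 0) :
    Function.Bijective (fun x => T x - w • x) := by
  have hsa : IsSelfAdjoint T := hT
  have h1 : w ∉ spectrum ℂ T := fun h => hw (hsa.im_eq_zero_of_mem_spectrum h)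
  rw [spectrum.notMem_iff] at h1
  obtain ⟨u, hu⟩ := h1
  have hu1 : ∀ x, (u : E →L[ℂ] E) x = w • x - T x := by
    intro x; rw [hu]; simp [Algebra.algebraMap_eq_smul_one]
  have c1 : ∀ x, (↑u⁻¹ : E →L[ℂ] E) ((u : E →L[ℂ] E) x) = x := by
    intro x
    rw [← mul_apply_eq_comp, Units.inv_mul]; rfl
  have c2 : ∀ x, (u : E →L[ℂ] E) ((↑u⁻¹ : E →L[ℂ] E) x) = x := by
    intro x
    rw [← mul_apply_eq_comp, Units.mul_inv]; rfl
  constructor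
  · intro x y hxy
    simp only at hxy
    rw [← c1 x, ← c1 y, hu1, hu1, ← neg_sub, hxy, neg_sub]
  · intro y
    refine ⟨-(↑u⁻¹ : E →L[ℂ] E) y, ?_⟩
    have := c2 y
    rw [hu1] at this
    simp only [map_neg, smul_neg]
    rw [sub_neg_eq_add, add_comm, ← sub_eq_add_neg]
    exact this

theorem tree_exists (ε : M → ℝ) (H : M → M → ℝ) (r : M × M → ℝ) (hH : ∀ a b, H a b = H b a)
    (h1 : ∀ a b, H a b ≠ 0 → ε a = - ε b) (h2 : ∀ a b, r (a, b) ≠ 0 → ε a = - ε b)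
    (h0 : ∀ a, ε a ≠ 0) :
    ∃ ψ : M → ℂ → ℂ, (∀ k, IsStieltjesPM (ψ k)) ∧ ∀ z ∈ offRplus, ∃ w : ℂ, w ≠ 0 ∧ w ^ 2 = z ∧
      ∃ G : M → M → ℂ,
        (∀ k k', ∑ a, (H k a : ℂ) * G a k' + (-w - ∑ l, (r (k, l) : ℂ) ^ 2 * G l l) * G k k'
          = if k = k' then 1 else 0) ∧
        ∀ k, (w * ψ k z) * (-w - ∑ l, (r (k, l) : ℂ) ^ 2 * G l l) = 1 := by
  choose μ hμ1 hμ2 hμ3 using fun k : M =>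
    spectral (Lcut H r) (Lcut_sa H r hH) (rt k) (norm_dl _)
  refine ⟨fun k z => ∫ t, ((t : ℂ) - z)⁻¹ ∂(μ k), fun k => ⟨μ k, hμ1 k, hμ2 k, fun z _ => rfl⟩, ?_⟩
  intro z hz
  obtain ⟨w, hw⟩ := IsAlgClosed.exists_pow_nat_eq z (n := 2) (by norm_num)
  have hwi : w.im ≠ 0 := by
    intro h
    apply hz
    have : w = (w.re : ℂ) := by apply Complex.ext <;> simp [h]
    rw [← hw, this, ← Complex.ofReal_pow]
    exact ⟨Complex.ofReal_im _, by rw [Complex.ofReal_re]; positivity⟩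
  have hw0 : w ≠ 0 := by rintro rfl; simp at hwi
  refine ⟨w, hw0, hw, ?_⟩
  have hbij := resolv (Lop H r) (Lop_sa H r hH) w hwi
  choose X hX using fun k : M => hbij.2 (rt k)
  simp only at hX
  have hS : ∀ (L : Hil (Vtx M) →L[ℂ] Hil (Vtx M)), ContinuousLinearMap.adjoint L = L →
      (∀ c v, L (Sop c (dl v)) = Sop c (Lop H r (dl v))
        + (if v = ([], c.2) then (r c : ℂ) • rt c.1 else 0)) →
      ∀ x k, L x - w • x = rt k → ∀ c : M × M,
        inner ℂ (rt c.2) (ContinuousLinearMap.adjoint (Sop c) x)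
          = - ((r c : ℂ) * inner ℂ (rt c.1) x * inner ℂ (rt c.2) (X c.2)) := by
    intro L hL hLS x k hx c
    have e1 := congrArg (ContinuousLinearMap.adjoint (Sop c)) hx
    rw [map_sub, map_smul, S_adj_rt, S_adj_gen H r hH c L hL (hLS c)] at e1
    have e2 : ContinuousLinearMap.adjoint (Sop c) x
        = (-((r c : ℂ) * inner ℂ (rt c.1) x)) • X c.2 := by
      apply hbij.1
      simp only [map_smul]
      rw [smul_comm w, ← smul_sub, hX, neg_smul, eq_neg_iff_add_eq_zero, ← e1]
      abel
    rw [e2, inner_smul_right]; ring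
  refine ⟨fun a b => inner ℂ (rt a) (X b), ?_, ?_⟩
  · intro k k'
    have e1 := congrArg (fun y => inner ℂ (rt k) y) (hX k')
    simp only [inner_sub_right, inner_smul_right, inner_Lop H r hH, inner_rt] at e1
    rw [← e1]
    simp only [fun l => hS _ (Lop_sa H r hH) (Lop_S H r) (X k') k' (hX k') (k, l)]
    rw [add_sub_assoc]
    congr 1
    rw [sub_mul, Finset.sum_mul, sub_eq_add_neg, add_comm, ← Finset.sum_neg_distrib, sub_eq_add_neg]
    congr 1
    · exact Finset.sum_congr rfl fun l _ => by ring
    · ring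
  · intro k
    obtain ⟨x, hx⟩ := (resolv (Lcut H r) (Lcut_sa H r hH) w hwi).2 (rt k)
    obtain ⟨y, hy⟩ := (resolv (Lcut H r) (Lcut_sa H r hH) (-w) (by simpa using hwi)).2 x
    simp only at hx hy
    have hy' : Lcut H r y = x - w • y := by rw [← hy]; simp
    have hx' : Lcut H r x = rt k + w • x := by rw [← hx]; simp
    have hyz : Lcut H r (Lcut H r y) - z • y = rt k := by
      rw [hy', map_sub, map_smul, hy', hx', ← hw, pow_two, mul_smul, smul_sub]
      abel
    have hψ := hμ3 k z hz y hyz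
    have hG := anti ε H r hH h1 h2
    have hbz : ∀ y', Lcut H r (Lcut H r y') - z • y' = 0 → y' = 0 := by
      intro y' h
      have q1 : Lcut H r y' - (-w) • y' = 0 := by
        apply (resolv (Lcut H r) (Lcut_sa H r hH) w hwi).1
        simp only [map_sub, map_smul, map_zero, smul_zero, sub_zero]
        rw [← h, ← hw, pow_two, mul_smul]
        simp only [neg_smul, smul_sub, smul_neg]
        abel
      apply (resolv (Lcut H r) (Lcut_sa H r hH) (-w) (by simpa using hwi)).1
      simpa using q1
    have hGy : Gop ε y = (ε k : ℂ) • y := by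
      rw [← sub_eq_zero]
      apply hbz
      have q : Gop ε (Lcut H r (Lcut H r y) - z • y) = (ε k : ℂ) • rt k := by
        rw [hyz, rt, Gop_dl]
      rw [map_sub, map_smul, hG, hG, map_neg, neg_neg] at q
      rw [map_sub, map_sub, map_smul, map_smul, smul_sub, smul_comm z, sub_sub_sub_comm, q,
        ← smul_sub, hyz, sub_self]
    have hz0 : inner ℂ (rt k) (Lcut H r y) = 0 := by
      have q1 : inner ℂ (Gop ε (rt k)) (Lcut H r y) = (ε k : ℂ) * inner ℂ (rt k) (Lcut H r y) := by
        rw [rt, Gop_dl, inner_smul_left]; simp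
      rw [← ContinuousLinearMap.adjoint_inner_right, Gop_sa, hG, hGy, map_smul, inner_neg_right,
        inner_smul_right] at q1
      have : (ε k : ℂ) ≠ 0 := by exact_mod_cast h0 k
      have q2 : (ε k : ℂ) * inner ℂ (rt k) (Lcut H r y) = 0 := by linear_combination -q1 / 2
      exact (mul_eq_zero.mp q2).resolve_left this
    have hg : inner ℂ (rt k) x = w * inner ℂ (rt k) y := by
      rw [← hy, inner_sub_right, hz0, inner_smul_right]; ring
    simp only
    rw [← hψ, ← hg]
    have e1 := congrArg (fun y => inner ℂ (rt k) y) hx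
    simp only [inner_sub_right, inner_smul_right, inner_Lcut H r hH, inner_rt] at e1
    simp only [fun l => hS _ (Lcut_sa H r hH) (Lcut_S H r) x k hx (k, l)] at e1
    rw [if_pos trivial] at e1
    rw [← e1, mul_sub, Finset.mul_sum, sub_eq_add_neg, add_comm, ← Finset.sum_neg_distrib,
      sub_eq_add_neg]
    congr 1
    · exact Finset.sum_congr rfl fun l _ => by ring
    · ring

end Tree

lemma schur {p q : Type*} [Fintype p] [Fintype q] [DecidableEq p] [DecidableEq q]
    (B : Matrix p q ℂ) (G1 : Matrix p p ℂ) (G2 : Matrix q p ℂ) (d1 ψ1 : p → ℂ) (d2 ψ2 : q → ℂ)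
    (w : ℂ) (hw : w ≠ 0) (h1 : ∀ i, (w * ψ1 i) * d1 i = 1) (h2 : ∀ i, (w * ψ2 i) * d2 i = 1)
    (e1 : B * G2 + Matrix.diagonal d1 * G1 = 1) (e2 : Bᵀ * G1 + Matrix.diagonal d2 * G2 = 0) :
    ((Matrix.diagonal ψ1)⁻¹ - w ^ 2 • (B * Matrix.diagonal ψ2 * Bᵀ))⁻¹ = w⁻¹ • G1 := by
  have hi : (Matrix.diagonal ψ1)⁻¹ = w • Matrix.diagonal d1 := by
    apply Matrix.inv_eq_right_inv
    rw [Matrix.mul_smul, Matrix.diagonal_mul_diagonal, ← Matrix.diagonal_smul,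
      ← Matrix.diagonal_one]
    congr 1
    ext i
    simp [← h1 i, mul_assoc]
  have hd : Matrix.diagonal ψ2 * Matrix.diagonal d2 = w⁻¹ • (1 : Matrix q q ℂ) := by
    rw [Matrix.diagonal_mul_diagonal, ← Matrix.diagonal_one, ← Matrix.diagonal_smul]
    congr 1
    ext i
    have := h2 i
    simp
    field_simp
    linear_combination this
  have h3 : Bᵀ * G1 = - (Matrix.diagonal d2 * G2) := eq_neg_of_add_eq_zero_left e2
  apply Matrix.inv_eq_right_inv
  rw [hi, sub_mul, Matrix.smul_mul, Matrix.smul_mul, Matrix.mul_smul, Matrix.mul_smul,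
    Matrix.mul_assoc (B * _), h3, Matrix.mul_neg, Matrix.mul_assoc B, ← Matrix.mul_assoc _ _ G2, hd,
    Matrix.smul_mul, Matrix.one_mul, Matrix.mul_smul, ← e1, smul_smul, mul_inv_cancel₀ hw, one_smul,
    smul_neg, smul_neg, smul_smul, smul_smul, sub_neg_eq_add, add_comm]
  congr 1
  rw [show w ^ 2 * w⁻¹ * w⁻¹ = 1 by field_simp, one_smul]

/-- Proposition 5.3 (existence of a solution of the system of `N + n` equations
in `S(ℝ₊)^{N+n}`). -/
theorem stmt_10 (N n : ℕ) (hN : 0 < N) (hn : 0 < n)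
    (σ : Fin N → Fin n → ℝ) (A : Matrix (Fin N) (Fin n) ℝ) :
    ∃ ψ ψt, SolvesSystem σ A ψ ψt := by
  let H : Fin N ⊕ Fin n → Fin N ⊕ Fin n → ℝ := fun a b => match a, b with
    | .inl i, .inr j => A i j
    | .inr j, .inl i => A i j
    | _, _ => 0
  let r : (Fin N ⊕ Fin n) × (Fin N ⊕ Fin n) → ℝ := fun c => match c.1, c.2 with
    | .inl i, .inr j => σ i j / Real.sqrt n
    | .inr j, .inl i => σ i j / Real.sqrt n
    | _, _ => 0
  let ε : Fin N ⊕ Fin n → ℝ := Sum.elim (fun _ => 1) (fun _ => -1)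
  obtain ⟨ψ, hψ, hz⟩ := tree_exists ε H r
    (by rintro (a | a) (b | b) <;> simp [H])
    (by rintro (a | a) (b | b) <;> simp [H, ε])
    (by rintro (a | a) (b | b) <;> simp [r, ε])
    (by rintro (a | a) <;> simp [ε])
  refine ⟨fun i => ψ (.inl i), fun j => ψ (.inr j), fun i => hψ _, fun j => hψ _, ?_⟩
  intro z hzz
  obtain ⟨w, hw0, hw, G, hG, hg⟩ := hz z hzz
  have hr : ∀ i j, (((σ i j / Real.sqrt n : ℝ) : ℂ)) ^ 2 = (n : ℂ)⁻¹ * (σ i j : ℂ) ^ 2 := by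
    intro i j
    rw [← Complex.ofReal_pow, div_pow, Real.sq_sqrt (by positivity)]
    push_cast
    ring
  let D1 : Fin N → ℂ := fun i => -w - ∑ j, (n : ℂ)⁻¹ * (σ i j : ℂ) ^ 2 * G (.inr j) (.inr j)
  let D2 : Fin n → ℂ := fun j => -w - ∑ i, (n : ℂ)⁻¹ * (σ i j : ℂ) ^ 2 * G (.inl i) (.inl i)
  have hD1 : ∀ i, -w - ∑ l, (r (.inl i, l) : ℂ) ^ 2 * G l l = D1 i := by
    intro i
    simp only [Fintype.sum_sum_type, r, hr, D1]
    simp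
  have hD2 : ∀ j, -w - ∑ l, (r (.inr j, l) : ℂ) ^ 2 * G l l = D2 j := by
    intro i
    simp only [Fintype.sum_sum_type, r, hr, D2]
    simp
  have g1 : ∀ i, (w * ψ (.inl i) z) * D1 i = 1 := fun i => by rw [← hD1, hg]
  have g2 : ∀ j, (w * ψ (.inr j) z) * D2 j = 1 := fun j => by rw [← hD2, hg]
  have k1 : ∀ i k', ∑ j, (A i j : ℂ) * G (.inr j) k' + D1 i * G (.inl i) k'
      = if .inl i = k' then 1 else 0 := by
    intro i k'
    rw [← hG, hD1]
    simp [Fintype.sum_sum_type, H]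
  have k2 : ∀ j k', ∑ i, (A i j : ℂ) * G (.inl i) k' + D2 j * G (.inr j) k'
      = if .inr j = k' then 1 else 0 := by
    intro i k'
    rw [← hG, hD2]
    simp [Fintype.sum_sum_type, H]
  have hT : Tmat A (fun i => ψ (.inl i)) (fun j => ψ (.inr j)) z
      = w⁻¹ • Matrix.of (fun i i' => G (.inl i) (.inl i')) := by
    rw [Tmat, ← hw]
    refine schur _ _ (Matrix.of fun j i => G (.inr j) (.inl i)) D1 _ D2 _ w hw0
      (by rw [hw]; exact g1) (by rw [hw]; exact g2) ?_ ?_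
    · ext i i'
      have := k1 i (.inl i')
      simp only [Sum.inl.injEq] at this
      simpa [Matrix.mul_apply, Matrix.diagonal_apply, Matrix.one_apply] using this
    · ext j i'
      have := k2 j (.inl i')
      simpa [Matrix.mul_apply, Matrix.diagonal_apply] using this
  have hTt : Ttmat A (fun i => ψ (.inl i)) (fun j => ψ (.inr j)) z
      = w⁻¹ • Matrix.of (fun i i' => G (.inr i) (.inr i')) := by
    rw [Ttmat, ← hw]
    refine schur ((A.map Complex.ofReal)ᵀ) _ (Matrix.of fun j i => G (.inl j) (.inr i)) D2 _ D1 _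
      w hw0 (by rw [hw]; exact g2) (by rw [hw]; exact g1) ?_ ?_
    · ext i i'
      have := k2 i (.inr i')
      simp only [Sum.inr.injEq] at this
      simpa [Matrix.mul_apply, Matrix.diagonal_apply, Matrix.one_apply] using this
    · ext j i'
      have := k1 j (.inr i')
      simpa [Matrix.mul_apply, Matrix.diagonal_apply] using this
  constructor
  · intro i
    have t : z * (1 + (n : ℂ)⁻¹ * ((Matrix.diagonal fun j => ((σ i j : ℂ))^2) *
        Ttmat A (fun i => ψ (.inl i)) (fun j => ψ (.inr j)) z).trace) = -(w * D1 i) := by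
      rw [hTt, Matrix.mul_smul, Matrix.trace_smul]
      simp only [Matrix.trace, Matrix.diag, Matrix.diagonal_mul, Matrix.of_apply, D1, smul_eq_mul,
        ← hw, mul_assoc, ← Finset.mul_sum]
      field_simp
      ring
    rw [t, inv_neg, neg_neg]
    exact eq_inv_of_mul_eq_one_left (by linear_combination g1 i)
  · intro j
    have t : z * (1 + (n : ℂ)⁻¹ * ((Matrix.diagonal fun i => ((σ i j : ℂ))^2) *
        Tmat A (fun i => ψ (.inl i)) (fun j => ψ (.inr j)) z).trace) = -(w * D2 j) := by
      rw [hT, Matrix.mul_smul, Matrix.trace_smul]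
      simp only [Matrix.trace, Matrix.diag, Matrix.diagonal_mul, Matrix.of_apply, D2, smul_eq_mul,
        ← hw, mul_assoc, ← Finset.mul_sum]
      field_simp
      ring
    rw [t, inv_neg, neg_neg]
    exact eq_inv_of_mul_eq_one_left (by linear_combination g2 j)
end
end
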